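/- If a Δ0 formula Σ(o_in, o_out, ā) implicitly defines o_out as a function of o_in (over all, possibly infinite, nested relations), then there is an NRC expression E such that whenever Σ(o_in, o_out, ā) holds, E(o_in) = o_out. -/

import Mathlib

inductive NTy : Type
  | ur : NTy
  | unit : NTy
  | prod : NTy → NTy → NTy
  | set : NTy → NTy
deriving DecidableEq

def NObj (U : Type) : NTy → Type
  | .ur => U
  | .unit => Unit
  | .prod a b => NObj U a × NObj U b
  | .set a => Set (NObj U a)

def NObj.asSet {U : Type} {T : NTy} (s : NObj U (NTy.set T)) : Set (NObj U T) := s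

def Env (U : Type) (Γ : List NTy) : Type := (i : Fin Γ.length) → NObj U (Γ.get i)

def Env.nil {U : Type} : Env U [] := fun i => i.elim0

def Env.cons {U : Type} {T : NTy} {Γ : List NTy} (x : NObj U T) (ρ : Env U Γ) :
    Env U (T :: Γ) := fun i =>
  Fin.cases (motive := fun i => NObj U ((T :: Γ).get i)) x (fun j => ρ j) i

inductive Tm : List NTy → NTy → Type
  | var {Γ} (i : Fin Γ.length) : Tm Γ (Γ.get i)
  | unit {Γ} : Tm Γ NTy.unit
  | pair {Γ a b} : Tm Γ a → Tm Γ b → Tm Γ (NTy.prod a b)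
  | fst {Γ a b} : Tm Γ (NTy.prod a b) → Tm Γ a
  | snd {Γ a b} : Tm Γ (NTy.prod a b) → Tm Γ b

def Tm.eval {U : Type} : ∀ {Γ T}, Tm Γ T → Env U Γ → NObj U T
  | _, _, .var i, ρ => ρ i
  | _, _, .unit, _ => ()
  | _, _, .pair s t, ρ => (s.eval ρ, t.eval ρ)
  | _, _, .fst t, ρ => (t.eval ρ).1
  | _, _, .snd t, ρ => (t.eval ρ).2

inductive D0 : List NTy → Type
  | eq {Γ} : Tm Γ NTy.ur → Tm Γ NTy.ur → D0 Γ
  | ne {Γ} : Tm Γ NTy.ur → Tm Γ NTy.ur → D0 Γ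
  | tru {Γ} : D0 Γ
  | fls {Γ} : D0 Γ
  | and {Γ} : D0 Γ → D0 Γ → D0 Γ
  | or {Γ} : D0 Γ → D0 Γ → D0 Γ
  | all {Γ T} : Tm Γ (NTy.set T) → D0 (T :: Γ) → D0 Γ
  | ex {Γ T} : Tm Γ (NTy.set T) → D0 (T :: Γ) → D0 Γ

def D0.Sat {U : Type} : ∀ {Γ}, D0 Γ → Env U Γ → Prop
  | _, .eq s t, ρ => s.eval ρ = t.eval ρ
  | _, .ne s t, ρ => s.eval ρ ≠ t.eval ρ
  | _, .tru, _ => True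
  | _, .fls, _ => False
  | _, .and φ ψ, ρ => φ.Sat ρ ∧ ψ.Sat ρ
  | _, .or φ ψ, ρ => φ.Sat ρ ∨ ψ.Sat ρ
  | _, .all t φ, ρ => ∀ x ∈ NObj.asSet (t.eval ρ), φ.Sat (Env.cons x ρ)
  | _, .ex t φ, ρ => ∃ x ∈ NObj.asSet (t.eval ρ), φ.Sat (Env.cons x ρ)

def Tm.fv : ∀ {Γ T}, Tm Γ T → Finset (Fin Γ.length)
  | _, _, .var i => {i}
  | _, _, .unit => ∅
  | _, _, .pair s t => s.fv ∪ t.fv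
  | _, _, .fst t => t.fv
  | _, _, .snd t => t.fv

def lowerFv {n : ℕ} (s : Finset (Fin (n + 1))) : Finset (Fin n) :=
  Finset.univ.filter (fun j => j.succ ∈ s)

def D0.fv : ∀ {Γ}, D0 Γ → Finset (Fin Γ.length)
  | _, .eq s t => s.fv ∪ t.fv
  | _, .ne s t => s.fv ∪ t.fv
  | _, .tru => ∅
  | _, .fls => ∅
  | _, .and φ ψ => φ.fv ∪ ψ.fv
  | _, .or φ ψ => φ.fv ∪ ψ.fv
  | _, .all t φ => t.fv ∪ lowerFv φ.fv
  | _, .ex t φ => t.fv ∪ lowerFv φ.fv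

open Classical

/-- The default object of each type (used by `get` on non-singletons). -/
def NObj.defaultObj (U : Type) [Inhabited U] : ∀ T : NTy, NObj U T
  | .ur => (default : U)
  | .unit => ()
  | .prod a b => (NObj.defaultObj U a, NObj.defaultObj U b)
  | .set _ => (∅ : Set _)

/-- The nested relational calculus `NRC`, with tuple operations, singleton, empty set,
union, difference, the comprehension/union operator `⋃{E₁ | x ∈ E₂}`, and the `get`
operator extracting the unique element of a singleton. -/
inductive NRC : List NTy → NTy → Type
  | var {Γ} (i : Fin Γ.length) : NRC Γ (Γ.get i)
  | unit {Γ} : NRC Γ NTy.unit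
  | pair {Γ a b} : NRC Γ a → NRC Γ b → NRC Γ (NTy.prod a b)
  | fst {Γ a b} : NRC Γ (NTy.prod a b) → NRC Γ a
  | snd {Γ a b} : NRC Γ (NTy.prod a b) → NRC Γ b
  | sing {Γ T} : NRC Γ T → NRC Γ (NTy.set T)
  | empty {Γ T} : NRC Γ (NTy.set T)
  | union {Γ T} : NRC Γ (NTy.set T) → NRC Γ (NTy.set T) → NRC Γ (NTy.set T)
  | diff {Γ T} : NRC Γ (NTy.set T) → NRC Γ (NTy.set T) → NRC Γ (NTy.set T)
  | bigUnion {Γ S T} : NRC (S :: Γ) (NTy.set T) → NRC Γ (NTy.set S) → NRC Γ (NTy.set T)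
  | get {Γ T} : NRC Γ (NTy.set T) → NRC Γ T

/-- Evaluation of `NRC` expressions on nested relational instances. -/
noncomputable def NRC.eval {U : Type} [Inhabited U] : ∀ {Γ T}, NRC Γ T → Env U Γ → NObj U T
  | _, _, .var i, ρ => ρ i
  | _, _, .unit, _ => ()
  | _, _, .pair s t, ρ => (s.eval ρ, t.eval ρ)
  | _, _, .fst t, ρ => (t.eval ρ).1
  | _, _, .snd t, ρ => (t.eval ρ).2
  | _, _, .sing e, ρ => ({e.eval ρ} : Set _)
  | _, _, .empty, _ => (∅ : Set _)
  | _, _, .union e₁ e₂, ρ => (NObj.asSet (e₁.eval ρ) ∪ NObj.asSet (e₂.eval ρ) : Set _)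
  | _, _, .diff e₁ e₂, ρ => (NObj.asSet (e₁.eval ρ) \ NObj.asSet (e₂.eval ρ) : Set _)
  | _, _, .bigUnion e₁ e₂, ρ =>
      { y | ∃ x ∈ NObj.asSet (e₂.eval ρ), y ∈ NObj.asSet (e₁.eval (Env.cons x ρ)) }
  | _, _, .get (T := T) e, ρ =>
      if h : ∃ x, e.eval ρ = ({x} : Set (NObj U T)) then h.choose else NObj.defaultObj U T

/-- Free variables of an `NRC` expression. -/
def NRC.fv : ∀ {Γ T}, NRC Γ T → Finset (Fin Γ.length)
  | _, _, .var i => {i}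
  | _, _, .unit => ∅
  | _, _, .pair s t => s.fv ∪ t.fv
  | _, _, .fst t => t.fv
  | _, _, .snd t => t.fv
  | _, _, .sing e => e.fv
  | _, _, .empty => ∅
  | _, _, .union e₁ e₂ => e₁.fv ∪ e₂.fv
  | _, _, .diff e₁ e₂ => e₁.fv ∪ e₂.fv
  | _, _, .bigUnion e₁ e₂ => lowerFv e₁.fv ∪ e₂.fv
  | _, _, .get e => e.fv

def mk3 {U : Type} {Ti To Ta : NTy} (i : NObj U Ti) (o : NObj U To) (a : NObj U Ta) :
    Env U [Ti, To, Ta] :=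
  Env.cons i (Env.cons o (Env.cons a Env.nil))

def mk1 {U : Type} {T : NTy} (x : NObj U T) : Env U [T] := Env.cons x Env.nil

/-! ### Basic object operations -/

namespace NObj

def pr {U : Type} {a b : NTy} (x : NObj U a) (y : NObj U b) : NObj U (.prod a b) := (x, y)
def p1 {U : Type} {a b : NTy} (x : NObj U (.prod a b)) : NObj U a := x.1
def p2 {U : Type} {a b : NTy} (x : NObj U (.prod a b)) : NObj U b := x.2
def mkS {U : Type} {a : NTy} (s : Set (NObj U a)) : NObj U (.set a) := s
def un {U : Type} : NObj U .unit := ()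

@[simp] theorem p1_pr {U : Type} {a b : NTy} (x : NObj U a) (y : NObj U b) : p1 (pr x y) = x := rfl
@[simp] theorem p2_pr {U : Type} {a b : NTy} (x : NObj U a) (y : NObj U b) : p2 (pr x y) = y := rfl
@[simp] theorem pr_eta {U : Type} {a b : NTy} (x : NObj U (.prod a b)) : pr (p1 x) (p2 x) = x := rfl
@[simp] theorem asSet_mkS {U : Type} {a : NTy} (s : Set (NObj U a)) : asSet (mkS s) = s := rfl
@[simp] theorem mkS_asSet {U : Type} {a : NTy} (s : NObj U (.set a)) : mkS (asSet s) = s := rfl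

theorem pr_inj {U : Type} {a b : NTy} {x x' : NObj U a} {y y' : NObj U b} :
    pr x y = pr x' y' ↔ x = x' ∧ y = y' := by
  constructor
  · intro h
    exact ⟨congrArg p1 h, congrArg p2 h⟩
  · rintro ⟨rfl, rfl⟩; rfl

theorem un_eq {U : Type} (x y : NObj U .unit) : x = y := rfl

theorem set_ext {U : Type} {a : NTy} {s t : NObj U (.set a)}
    (h : ∀ z, z ∈ asSet s ↔ z ∈ asSet t) : s = t := by
  have : asSet s = asSet t := Set.ext h
  exact this

theorem nonempty {U : Type} [Nonempty U] (T : NTy) : Nonempty (NObj U T) := by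
  induction T with
  | ur => exact (inferInstance : Nonempty U)
  | unit => exact ⟨un⟩
  | prod a b iha ihb => exact ⟨pr iha.some ihb.some⟩
  | set a _ => exact ⟨mkS ∅⟩

end NObj

open NObj

/-! ### Combinators -/

/-- Variable-free presentation of NRC. -/
inductive Fn : NTy → NTy → Type
  | id (S) : Fn S S
  | comp {A B C} : Fn B C → Fn A B → Fn A C
  | unit {S} : Fn S .unit
  | pair {S A B} : Fn S A → Fn S B → Fn S (.prod A B)
  | fst {A B} : Fn (.prod A B) A
  | snd {A B} : Fn (.prod A B) B
  | sing {T} : Fn T (.set T)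
  | empty {S T} : Fn S (.set T)
  | union {S T} : Fn S (.set T) → Fn S (.set T) → Fn S (.set T)
  | diff {S T} : Fn S (.set T) → Fn S (.set T) → Fn S (.set T)
  | bigU {S A T} : Fn (.prod A S) (.set T) → Fn S (.set A) → Fn S (.set T)

def Fn.eval {U : Type} : ∀ {S T}, Fn S T → NObj U S → NObj U T
  | _, _, .id _, s => s
  | _, _, .comp f g, s => f.eval (g.eval s)
  | _, _, .unit, _ => un
  | _, _, .pair f g, s => pr (f.eval s) (g.eval s)
  | _, _, .fst, s => p1 s
  | _, _, .snd, s => p2 s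
  | _, _, .sing, s => mkS {s}
  | _, _, .empty, _ => mkS ∅
  | _, _, .union f g, s => mkS (asSet (f.eval s) ∪ asSet (g.eval s))
  | _, _, .diff f g, s => mkS (asSet (f.eval s) \ asSet (g.eval s))
  | _, _, .bigU f g, s => mkS {y | ∃ x ∈ asSet (g.eval s), y ∈ asSet (f.eval (pr x s))}

namespace Fn
variable {U : Type} {S T A B C : NTy}
@[simp] theorem eval_id (s : NObj U S) : (Fn.id S).eval s = s := rfl
@[simp] theorem eval_comp (f : Fn B C) (g : Fn A B) (s : NObj U A) :
    (f.comp g).eval s = f.eval (g.eval s) := rfl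
@[simp] theorem eval_unit (s : NObj U S) : (Fn.unit).eval s = un := rfl
@[simp] theorem eval_pair (f : Fn S A) (g : Fn S B) (s : NObj U S) :
    (f.pair g).eval s = pr (f.eval s) (g.eval s) := rfl
@[simp] theorem eval_fst (s : NObj U (.prod A B)) : Fn.fst.eval s = p1 s := rfl
@[simp] theorem eval_snd (s : NObj U (.prod A B)) : Fn.snd.eval s = p2 s := rfl
@[simp] theorem mem_sing (s z : NObj U T) : z ∈ asSet (Fn.sing.eval s) ↔ z = s := Iff.rfl
@[simp] theorem mem_empty (s : NObj U S) (z : NObj U T) :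
    z ∈ asSet ((Fn.empty : Fn S (.set T)).eval s) ↔ False := Iff.rfl
@[simp] theorem mem_union (f g : Fn S (.set T)) (s : NObj U S) (z : NObj U T) :
    z ∈ asSet ((f.union g).eval s) ↔ z ∈ asSet (f.eval s) ∨ z ∈ asSet (g.eval s) := Iff.rfl
@[simp] theorem mem_diff (f g : Fn S (.set T)) (s : NObj U S) (z : NObj U T) :
    z ∈ asSet ((f.diff g).eval s) ↔ z ∈ asSet (f.eval s) ∧ ¬ z ∈ asSet (g.eval s) := Iff.rfl
@[simp] theorem mem_bigU (f : Fn (.prod A S) (.set T)) (g : Fn S (.set A)) (s : NObj U S)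
    (z : NObj U T) :
    z ∈ asSet ((f.bigU g).eval s) ↔ ∃ x ∈ asSet (g.eval s), z ∈ asSet (f.eval (pr x s)) := Iff.rfl
end Fn

/-! ### Countability -/

def NTy.code : NTy → ℕ
  | .ur => Nat.pair 0 0
  | .unit => Nat.pair 1 0
  | .prod a b => Nat.pair 2 (Nat.pair a.code b.code)
  | .set a => Nat.pair 3 a.code

theorem NTy.code_inj : ∀ a b : NTy, a.code = b.code → a = b := by
  intro a
  induction a <;> intro b h <;> cases b <;> simp_all [NTy.code, Nat.pair_eq_pair]
  all_goals grind

instance : Countable NTy := ⟨NTy.code, fun a b h => NTy.code_inj a b h⟩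

def Fn.code : ∀ {S T}, Fn S T → ℕ
  | _, _, .id _ => Nat.pair 0 0
  | _, _, .comp (B := B) f g => Nat.pair 1 (Nat.pair B.code (Nat.pair f.code g.code))
  | _, _, .unit => Nat.pair 2 0
  | _, _, .pair f g => Nat.pair 3 (Nat.pair f.code g.code)
  | _, _, .fst => Nat.pair 4 0
  | _, _, .snd => Nat.pair 5 0
  | _, _, .sing => Nat.pair 6 0
  | _, _, .empty => Nat.pair 7 0
  | _, _, .union f g => Nat.pair 8 (Nat.pair f.code g.code)
  | _, _, .diff f g => Nat.pair 9 (Nat.pair f.code g.code)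
  | _, _, .bigU (A := A) f g => Nat.pair 10 (Nat.pair A.code (Nat.pair f.code g.code))

theorem Fn.code_inj {S T : NTy} : ∀ f g : Fn S T, f.code = g.code → f = g := by
  intro f
  induction f with
  | comp f f' ih ih' =>
    intro g h
    cases g <;> simp [Fn.code, Nat.pair_eq_pair] at h ⊢
    obtain ⟨h1, h2, h3⟩ := h
    have := NTy.code_inj _ _ h1
    subst this
    exact ⟨rfl, heq_of_eq (ih _ h2), heq_of_eq (ih' _ h3)⟩
  | bigU f f' ih ih' =>
    intro g h
    cases g <;> simp [Fn.code, Nat.pair_eq_pair] at h ⊢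
    obtain ⟨h1, h2, h3⟩ := h
    have := NTy.code_inj _ _ h1
    subst this
    exact ⟨rfl, heq_of_eq (ih _ h2), heq_of_eq (ih' _ h3)⟩
  | pair f f' ih ih' =>
    intro g h
    cases g <;> simp [Fn.code, Nat.pair_eq_pair] at h ⊢
    exact ⟨ih _ h.1, ih' _ h.2⟩
  | union f f' ih ih' =>
    intro g h
    cases g <;> simp [Fn.code, Nat.pair_eq_pair] at h ⊢
    exact ⟨ih _ h.1, ih' _ h.2⟩
  | diff f f' ih ih' =>
    intro g h
    cases g <;> simp [Fn.code, Nat.pair_eq_pair] at h ⊢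
    exact ⟨ih _ h.1, ih' _ h.2⟩
  | _ =>
    intro g h
    cases g <;> simp [Fn.code, Nat.pair_eq_pair] at h ⊢

instance {S T : NTy} : Countable (Fn S T) := ⟨Fn.code, fun a b h => Fn.code_inj a b h⟩

/-! ### Translation into NRC -/

theorem Fn.toNRC {S T : NTy} (f : Fn S T) : ∀ {Γ : List NTy} (e : NRC Γ S),
    ∃ e' : NRC Γ T, ∀ (U : Type) [Inhabited U] (ρ : Env U Γ), e'.eval ρ = f.eval (e.eval ρ) := by
  induction f with
  | id => intro Γ e; exact ⟨e, fun _ _ _ => rfl⟩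
  | comp f g ihf ihg =>
    intro Γ e
    obtain ⟨e1, h1⟩ := ihg e
    obtain ⟨e2, h2⟩ := ihf e1
    exact ⟨e2, fun U _ ρ => by rw [h2, h1]; rfl⟩
  | unit => intro Γ e; exact ⟨.unit, fun _ _ _ => rfl⟩
  | pair f g ihf ihg =>
    intro Γ e
    obtain ⟨e1, h1⟩ := ihf e
    obtain ⟨e2, h2⟩ := ihg e
    exact ⟨.pair e1 e2, fun U _ ρ => by simp only [NRC.eval, h2, h1]; rfl⟩
  | fst => intro Γ e; exact ⟨.fst e, fun _ _ _ => rfl⟩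
  | snd => intro Γ e; exact ⟨.snd e, fun _ _ _ => rfl⟩
  | sing => intro Γ e; exact ⟨.sing e, fun _ _ _ => rfl⟩
  | empty => intro Γ e; exact ⟨.empty, fun _ _ _ => rfl⟩
  | union f g ihf ihg =>
    intro Γ e
    obtain ⟨e1, h1⟩ := ihf e
    obtain ⟨e2, h2⟩ := ihg e
    exact ⟨.union e1 e2, fun U _ ρ => by simp only [NRC.eval, h2, h1]; rfl⟩
  | diff f g ihf ihg =>
    intro Γ e
    obtain ⟨e1, h1⟩ := ihf e
    obtain ⟨e2, h2⟩ := ihg e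
    exact ⟨.diff e1 e2, fun U _ ρ => by simp only [NRC.eval, h2, h1]; rfl⟩
  | @bigU S A T f g ihf ihg =>
    intro Γ e
    obtain ⟨e2, h2⟩ := ihg (NRC.var (Γ := S :: Γ) ⟨0, by simp⟩)
    obtain ⟨e1, h1⟩ := ihf (NRC.pair (NRC.var (Γ := A :: S :: Γ) ⟨0, by simp⟩)
      (NRC.var (Γ := A :: S :: Γ) ⟨1, by simp⟩))
    refine ⟨.bigUnion (.bigUnion e1 e2) (.sing e), fun U _ ρ => ?_⟩
    apply NObj.set_ext
    intro z
    rw [Fn.mem_bigU]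
    have key : z ∈ asSet (((NRC.bigUnion e1 e2).bigUnion e.sing).eval ρ) ↔
      ∃ s ∈ ({e.eval ρ} : Set (NObj U S)), ∃ x ∈ asSet (e2.eval (Env.cons s ρ)),
        z ∈ asSet (e1.eval (Env.cons x (Env.cons s ρ))) := Iff.rfl
    rw [key]
    simp only [Set.mem_singleton_iff, exists_eq_left]
    refine exists_congr fun x => ?_
    rw [h2 U, h1 U]
    rfl

/-! ### Predicates -/

abbrev Pd (S : NTy) := Fn S (.set .unit)

def Holds {U : Type} {S : NTy} (p : Pd S) (s : NObj U S) : Prop := un ∈ asSet (p.eval s)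

namespace Pd
variable {U : Type} {S T A B C : NTy}

def tt : Pd S := Fn.sing.comp Fn.unit
def and (p q : Pd S) : Pd S := Fn.bigU (q.comp Fn.snd) p
def or (p q : Pd S) : Pd S := Fn.union p q
def not (p : Pd S) : Pd S := Fn.diff tt p
def ex (g : Fn S (.set A)) (p : Pd (.prod A S)) : Pd S := Fn.bigU p g
def filt (g : Fn S (.set A)) (p : Pd (.prod A S)) : Fn S (.set A) :=
  Fn.bigU (Fn.bigU (Fn.sing.comp (Fn.fst.comp Fn.snd)) p) g
def eqP (f g : Fn S A) : Pd S :=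
  not (ex (Fn.diff (Fn.sing.comp f) (Fn.sing.comp g)) tt)
def memP (f : Fn S A) (g : Fn S (.set A)) : Pd S :=
  ex g (eqP Fn.fst (f.comp Fn.snd))

@[simp] theorem holds_tt (s : NObj U S) : Holds tt s := by simp [Holds, tt]
@[simp] theorem holds_comp (p : Pd B) (f : Fn A B) (s : NObj U A) :
    Holds (p.comp f) s ↔ Holds p (f.eval s) := Iff.rfl
@[simp] theorem holds_and (p q : Pd S) (s : NObj U S) :
    Holds (and p q) s ↔ Holds p s ∧ Holds q s := by
  simp only [Holds, and, Fn.mem_bigU, Fn.eval_comp, Fn.eval_snd, p2_pr]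
  exact ⟨fun ⟨x, h, h'⟩ => ⟨h, h'⟩, fun ⟨h, h'⟩ => ⟨_, h, h'⟩⟩
@[simp] theorem holds_or (p q : Pd S) (s : NObj U S) :
    Holds (or p q) s ↔ Holds p s ∨ Holds q s := Iff.rfl
@[simp] theorem holds_not (p : Pd S) (s : NObj U S) : Holds (not p) s ↔ ¬ Holds p s := by
  have := holds_tt s
  simp only [Holds, not, Fn.mem_diff] at *
  tauto
@[simp] theorem holds_ex (g : Fn S (.set A)) (p : Pd (.prod A S)) (s : NObj U S) :
    Holds (ex g p) s ↔ ∃ x ∈ asSet (g.eval s), Holds p (pr x s) := Iff.rfl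
@[simp] theorem mem_filt (g : Fn S (.set A)) (p : Pd (.prod A S)) (s : NObj U S) (z : NObj U A) :
    z ∈ asSet ((filt g p).eval s) ↔ z ∈ asSet (g.eval s) ∧ Holds p (pr z s) := by
  simp only [filt, Fn.mem_bigU, Fn.eval_comp, Fn.mem_sing, Fn.eval_fst, Fn.eval_snd, p2_pr, p1_pr]
  constructor
  · rintro ⟨x, h, y, h', rfl⟩
    exact ⟨h, h'⟩
  · rintro ⟨h, h'⟩
    exact ⟨z, h, _, h', rfl⟩
@[simp] theorem holds_eqP (f g : Fn S A) (s : NObj U S) :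
    Holds (eqP f g) s ↔ f.eval s = g.eval s := by
  simp [eqP]
@[simp] theorem holds_memP (f : Fn S A) (g : Fn S (.set A)) (s : NObj U S) :
    Holds (memP f g) s ↔ f.eval s ∈ asSet (g.eval s) := by
  simp [memP]

/-- Boolean combinations of a list of predicates. -/
def bc : List (Pd S) → List (Pd S)
  | [] => [tt, not tt]
  | p :: L => (bc L).flatMap fun φ => (bc L).map fun ψ => or (and p φ) (and (not p) ψ)

theorem bc_spec {X : Type*} (V : X → Type) (pt : ∀ x, NObj (V x) S) (L : List (Pd S)) :
    ∀ (D A : X → Prop),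
    (∀ x y, D x → D y → (∀ p ∈ L, Holds p (pt x) ↔ Holds p (pt y)) → A x → A y) →
    ∃ φ ∈ bc L, ∀ x, D x → (Holds φ (pt x) ↔ A x) := by
  induction L with
  | nil =>
    intro D A h
    by_cases hA : ∃ x, D x ∧ A x
    · obtain ⟨x, hD, hA⟩ := hA
      exact ⟨tt, by simp [bc], fun y hy => by simpa using h x y hD hy (by simp) hA⟩
    · push Not at hA
      exact ⟨not tt, by simp [bc], fun y hy => by simpa using hA y hy⟩
  | cons p L ih =>
    intro D A h
    obtain ⟨φ, hφ, h1⟩ := ih (fun x => D x ∧ Holds p (pt x)) A (by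
      intro x y hx hy hL
      refine h x y hx.1 hy.1 ?_
      simp only [List.mem_cons, forall_eq_or_imp]
      exact ⟨by simp [hx.2, hy.2], hL⟩)
    obtain ⟨ψ, hψ, h2⟩ := ih (fun x => D x ∧ ¬ Holds p (pt x)) A (by
      intro x y hx hy hL
      refine h x y hx.1 hy.1 ?_
      simp only [List.mem_cons, forall_eq_or_imp]
      exact ⟨by simp [hx.2, hy.2], hL⟩)
    refine ⟨or (and p φ) (and (not p) ψ), ?_, ?_⟩
    · simp only [bc, List.mem_flatMap, List.mem_map]
      exact ⟨φ, hφ, ψ, hψ, rfl⟩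
    · intro x hx
      have a1 := h1 x
      have a2 := h2 x
      simp only [holds_or, holds_and, holds_not]
      by_cases hp : Holds p (pt x) <;> simp_all

end Pd

/-- finite unions -/
def unionL {S T : NTy} : List (Fn S (.set T)) → Fn S (.set T)
  | [] => .empty
  | f :: L => .union f (unionL L)

theorem mem_unionL {U : Type} {S T : NTy} (L : List (Fn S (.set T))) (s : NObj U S)
    (z : NObj U T) : z ∈ asSet ((unionL L).eval s) ↔ ∃ f ∈ L, z ∈ asSet (f.eval s) := by
  induction L with
  | nil => simp [unionL]
  | cons f L ih => simp [unionL, ih]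

/-! ### Translating Δ₀ formulas -/

def tup : List NTy → NTy
  | [] => .unit
  | T :: Γ => .prod T (tup Γ)

def enc {U : Type} : ∀ {Γ : List NTy}, Env U Γ → NObj U (tup Γ)
  | [], _ => un
  | _ :: Γ, ρ => pr (ρ ⟨0, Nat.succ_pos _⟩) (enc (Γ := Γ) fun j => ρ j.succ)

theorem enc_cons {U : Type} {T : NTy} {Γ : List NTy} (x : NObj U T) (ρ : Env U Γ) :
    enc (Env.cons x ρ) = pr x (enc ρ) := rfl

theorem var_tr : ∀ (Γ : List NTy) (i : Fin Γ.length),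
    ∃ f : Fn (tup Γ) (Γ.get i), ∀ (U : Type) (ρ : Env U Γ), f.eval (enc ρ) = ρ i := by
  intro Γ
  induction Γ with
  | nil => intro i; exact i.elim0
  | cons T Γ ih =>
    intro i
    induction i using Fin.cases with
    | zero => exact ⟨Fn.fst, fun U ρ => rfl⟩
    | succ j =>
      obtain ⟨f, hf⟩ := ih j
      exact ⟨f.comp Fn.snd, fun U ρ => hf U (fun j => ρ j.succ)⟩

theorem Tm.tr {Γ T} (t : Tm Γ T) :
    ∃ f : Fn (tup Γ) T, ∀ (U : Type) (ρ : Env U Γ), f.eval (enc ρ) = t.eval ρ := by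
  induction t with
  | var i =>
    obtain ⟨f, hf⟩ := var_tr _ i
    exact ⟨f, fun U ρ => by rw [hf, Tm.eval]⟩
  | unit => exact ⟨.unit, fun _ _ => rfl⟩
  | pair s t ih1 ih2 =>
    obtain ⟨f, hf⟩ := ih1
    obtain ⟨g, hg⟩ := ih2
    exact ⟨.pair f g, fun U ρ => by rw [Fn.eval_pair, hf, hg, Tm.eval]; rfl⟩
  | fst t ih =>
    obtain ⟨f, hf⟩ := ih
    exact ⟨.comp .fst f, fun U ρ => by rw [Fn.eval_comp, hf, Tm.eval]; rfl⟩
  | snd t ih =>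
    obtain ⟨f, hf⟩ := ih
    exact ⟨.comp .snd f, fun U ρ => by rw [Fn.eval_comp, hf, Tm.eval]; rfl⟩

theorem D0.tr {Γ} (φ : D0 Γ) :
    ∃ p : Pd (tup Γ), ∀ (U : Type) (ρ : Env U Γ), Holds p (enc ρ) ↔ φ.Sat ρ := by
  induction φ with
  | eq s t =>
    obtain ⟨f, hf⟩ := s.tr
    obtain ⟨g, hg⟩ := t.tr
    exact ⟨Pd.eqP f g, fun U ρ => by simp [hf, hg, D0.Sat]⟩
  | ne s t =>
    obtain ⟨f, hf⟩ := s.tr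
    obtain ⟨g, hg⟩ := t.tr
    exact ⟨Pd.not (Pd.eqP f g), fun U ρ => by simp [hf, hg, D0.Sat]⟩
  | tru => exact ⟨Pd.tt, fun U ρ => by simp [D0.Sat]⟩
  | fls => exact ⟨Pd.not Pd.tt, fun U ρ => by simp [D0.Sat]⟩
  | and a b iha ihb =>
    obtain ⟨f, hf⟩ := iha
    obtain ⟨g, hg⟩ := ihb
    exact ⟨Pd.and f g, fun U ρ => by simp [hf, hg, D0.Sat]⟩
  | or a b iha ihb =>
    obtain ⟨f, hf⟩ := iha
    obtain ⟨g, hg⟩ := ihb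
    exact ⟨Pd.or f g, fun U ρ => by simp [hf, hg, D0.Sat]⟩
  | @all Γ T t φ ih =>
    obtain ⟨f, hf⟩ := t.tr
    obtain ⟨p, hp⟩ := ih
    let p' : Pd (.prod T (tup Γ)) := p
    refine ⟨Pd.not (Pd.ex f (Pd.not p')), fun U ρ => ?_⟩
    rw [Pd.holds_not, Pd.holds_ex, D0.Sat, hf]
    simp only [Pd.holds_not, not_exists, not_and, not_not]
    refine forall_congr' fun x => forall_congr' fun _ => ?_
    exact hp U (Env.cons x ρ)
  | @ex Γ T t φ ih =>
    obtain ⟨f, hf⟩ := t.tr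
    obtain ⟨p, hp⟩ := ih
    let p' : Pd (.prod T (tup Γ)) := p
    refine ⟨Pd.ex f p', fun U ρ => ?_⟩
    rw [Pd.holds_ex, D0.Sat, hf]
    refine exists_congr fun x => and_congr_right fun _ => ?_
    exact hp U (Env.cons x ρ)

/-! ### Functoriality under injections -/

def NObj.map {U V : Type} (j : U → V) : ∀ {T : NTy}, NObj U T → NObj V T
  | .ur, x => j x
  | .unit, _ => un
  | .prod _ _, x => pr (map j (p1 x)) (map j (p2 x))
  | .set _, s => mkS {y | ∃ x ∈ asSet s, y = map j x}

namespace NObj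
variable {U V : Type} (j : U → V)
theorem map_pr {a b : NTy} (x : NObj U a) (y : NObj U b) : map j (pr x y) = pr (map j x) (map j y) :=
  rfl
theorem map_p1 {a b : NTy} (x : NObj U (.prod a b)) : p1 (map j x) = map j (p1 x) := rfl
theorem map_p2 {a b : NTy} (x : NObj U (.prod a b)) : p2 (map j x) = map j (p2 x) := rfl
theorem mem_map {a : NTy} (s : NObj U (.set a)) (z : NObj V a) :
    z ∈ asSet (map j s) ↔ ∃ x ∈ asSet s, z = map j x := Iff.rfl

theorem map_inj (hj : Function.Injective j) : ∀ {T : NTy} (x y : NObj U T), map j x = map j y → x = y := by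
  intro T
  induction T with
  | ur => intro x y h; exact hj h
  | unit => intro x y _; exact un_eq x y
  | prod a b iha ihb =>
    intro x y h
    have h1 := iha _ _ (congrArg p1 h)
    have h2 := ihb _ _ (congrArg p2 h)
    rw [← pr_eta x, ← pr_eta y, h1, h2]
  | set a ih =>
    intro x y h
    apply set_ext
    intro z
    constructor
    · intro hz
      have : map j z ∈ asSet (map j y) := by rw [← h]; exact ⟨z, hz, rfl⟩
      obtain ⟨w, hw, e⟩ := this
      rwa [ih _ _ e]
    · intro hz
      have : map j z ∈ asSet (map j x) := by rw [h]; exact ⟨z, hz, rfl⟩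
      obtain ⟨w, hw, e⟩ := this
      rwa [ih _ _ e]

end NObj

theorem Fn.eval_map {U V : Type} (j : U → V) (hj : Function.Injective j) {S T : NTy} (f : Fn S T) :
    ∀ s : NObj U S, f.eval (NObj.map j s) = NObj.map j (f.eval s) := by
  induction f with
  | id => intro s; rfl
  | comp f g ihf ihg => intro s; simp [ihf, ihg]
  | unit => intro s; rfl
  | pair f g ihf ihg => intro s; simp [ihf, ihg, map_pr]
  | fst => intro s; rfl
  | snd => intro s; rfl
  | sing =>
    intro s
    apply set_ext
    intro z
    simp [mem_map]
  | empty =>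
    intro s
    apply set_ext
    intro z
    simp [mem_map]
  | union f g ihf ihg =>
    intro s
    apply set_ext
    intro z
    simp only [Fn.mem_union, mem_map, ihf, ihg]
    grind
  | diff f g ihf ihg =>
    intro s
    apply set_ext
    intro z
    simp only [Fn.mem_diff, mem_map, ihf, ihg]
    constructor
    · rintro ⟨⟨x, hx, rfl⟩, h⟩
      exact ⟨x, ⟨hx, fun h' => h ⟨x, h', rfl⟩⟩, rfl⟩
    · rintro ⟨x, ⟨hx, h⟩, rfl⟩
      refine ⟨⟨x, hx, rfl⟩, ?_⟩
      rintro ⟨y, hy, e⟩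
      rw [map_inj j hj _ _ e] at h
      exact h hy
  | bigU f g ihf ihg =>
    intro s
    apply set_ext
    intro z
    simp only [Fn.mem_bigU, mem_map, ihg]
    constructor
    · rintro ⟨x, ⟨x, hx, rfl⟩, h⟩
      rw [← map_pr, ihf] at h
      obtain ⟨w, hw, rfl⟩ := h
      exact ⟨w, ⟨x, hx, hw⟩, rfl⟩
    · rintro ⟨w, ⟨x, hx, hw⟩, rfl⟩
      refine ⟨_, ⟨x, hx, rfl⟩, ?_⟩
      rw [← map_pr, ihf]
      exact ⟨w, hw, rfl⟩

theorem holds_map {U V : Type} (j : U → V) (hj : Function.Injective j) {S : NTy} (p : Pd S)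
    (s : NObj U S) : Holds p (NObj.map j s) ↔ Holds p s := by
  unfold Holds
  rw [Fn.eval_map j hj, mem_map]
  exact ⟨fun ⟨x, h, _⟩ => h, fun h => ⟨_, h, rfl⟩⟩

/-! ### Ultraproducts -/

/-- eventually along a fixed nonprincipal ultrafilter -/
def EV (P : ℕ → Prop) : Prop := ∀ᶠ k in (Filter.hyperfilter ℕ : Filter ℕ), P k

namespace EV
theorem mono {P Q : ℕ → Prop} (h : EV P) (h' : ∀ k, P k → Q k) : EV Q :=
  Filter.Eventually.mono h h'
theorem and {P Q : ℕ → Prop} (h : EV P) (h' : EV Q) : EV fun k => P k ∧ Q k :=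
  Filter.Eventually.and h h'
theorem of_all {P : ℕ → Prop} (h : ∀ k, P k) : EV P := Filter.Eventually.of_forall h
theorem not_iff {P : ℕ → Prop} : EV (fun k => ¬ P k) ↔ ¬ EV P := Ultrafilter.eventually_not
theorem or_iff {P Q : ℕ → Prop} : EV (fun k => P k ∨ Q k) ↔ EV P ∨ EV Q :=
  Ultrafilter.eventually_or
theorem and_iff {P Q : ℕ → Prop} : EV (fun k => P k ∧ Q k) ↔ EV P ∧ EV Q :=
  Filter.eventually_and
theorem exists_of {P : ℕ → Prop} (h : EV P) : ∃ k, P k := Filter.Eventually.exists h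
theorem congr {P Q : ℕ → Prop} (h : EV fun k => P k ↔ Q k) : EV P ↔ EV Q :=
  Filter.eventually_congr h
theorem ge (n : ℕ) : EV fun k => n ≤ k := by
  have : ∀ᶠ k in (Filter.cofinite : Filter ℕ), n ≤ k := by
    rw [Nat.cofinite_eq_atTop]; exact Filter.eventually_ge_atTop n
  exact Filter.Eventually.filter_mono Filter.hyperfilter_le_cofinite this
theorem all_le {Q : ℕ → ℕ → Prop} (n : ℕ) (h : ∀ j ≤ n, EV (Q j)) : EV fun k => ∀ j ≤ n, Q j k := by
  induction n with
  | zero =>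
    exact (h 0 le_rfl).mono fun k hk j hj => by
      obtain rfl : j = 0 := by omega
      exact hk
  | succ n ih =>
    have := (ih fun j hj => h j (by omega)).and (h (n+1) le_rfl)
    exact this.mono fun k hk j hj => by
      rcases Nat.lt_or_ge j (n+1) with h' | h'
      · exact hk.1 j (by omega)
      · obtain rfl : j = n+1 := by omega
        exact hk.2
theorem all_list {α : Type*} {Q : α → ℕ → Prop} (L : List α) (h : ∀ j ∈ L, EV (Q j)) :
    EV fun k => ∀ j ∈ L, Q j k := by
  induction L with
  | nil => exact of_all (by simp)
  | cons a L ih =>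
    have := (ih fun j hj => h j (by simp [hj])).and (h a (by simp))
    exact this.mono fun k hk => by
      simp only [List.mem_cons, forall_eq_or_imp]
      exact ⟨hk.2, hk.1⟩
theorem decide {P : ℕ → Prop} : EV fun k => P k ↔ EV P := by
  by_cases h : EV P
  · exact h.mono fun k hk => by simp [hk, h]
  · exact (not_iff.2 h).mono fun k hk => by simp [hk, h]
/-- skolemization -/
theorem choice {Z : ℕ → Type*} [∀ k, Nonempty (Z k)] {Q : ∀ k, Z k → Prop}
    (h : EV fun k => ∃ z, Q k z) : ∃ z : ∀ k, Z k, EV fun k => Q k (z k) := by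
  refine ⟨fun k => if h : ∃ z, Q k z then h.choose else Classical.arbitrary _, ?_⟩
  refine h.mono fun k hk => ?_
  simp only [dif_pos hk]
  exact hk.choose_spec

/-- countable saturation -/
theorem saturation {Z : ℕ → Type*} [∀ k, Nonempty (Z k)] (Q : ℕ → ∀ k, Z k → Prop)
    (h : ∀ n, EV fun k => ∃ z, ∀ j ≤ n, Q j k z) :
    ∃ z : ∀ k, Z k, ∀ n, EV fun k => Q n k (z k) := by
  have key : ∀ k N, ∃ z : Z k, ∀ n ≤ N, (∃ z', ∀ j ≤ n, Q j k z') → ∀ j ≤ n, Q j k z := by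
    intro k N
    induction N with
    | zero =>
      by_cases h : ∃ z', ∀ j ≤ 0, Q j k z'
      · obtain ⟨z, hz⟩ := h
        refine ⟨z, fun n hn _ => ?_⟩
        obtain rfl : n = 0 := by omega
        exact hz
      · refine ⟨Classical.arbitrary _, fun n hn h' => ?_⟩
        obtain rfl : n = 0 := by omega
        exact absurd h' h
    | succ N ih =>
      by_cases h : ∃ z', ∀ j ≤ N+1, Q j k z'
      · obtain ⟨z, hz⟩ := h
        exact ⟨z, fun n hn _ j hj => hz j (by omega)⟩
      · obtain ⟨z, hz⟩ := ih
        refine ⟨z, fun n hn h' => ?_⟩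
        rcases Nat.lt_or_ge n (N+1) with h1 | h1
        · exact hz n (by omega) h'
        · obtain rfl : n = N+1 := by omega
          exact absurd h' h
  choose z hz using fun k => key k k
  refine ⟨z, fun n => ?_⟩
  exact ((ge n).and (h n)).mono fun k hk => hz k n hk.1 hk.2 n le_rfl
end EV

abbrev UM (U : ℕ → Type) (T : NTy) := ∀ k, NObj (U k) T

namespace UM
variable {U : ℕ → Type}

def ap {S T : NTy} (f : Fn S T) (n : UM U S) : UM U T := fun k => f.eval (n k)
def mk {S T : NTy} (m : UM U S) (n : UM U T) : UM U (.prod S T) := fun k => pr (m k) (n k)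
def MemE {T : NTy} (m : UM U T) (s : UM U (.set T)) : Prop := EV fun k => m k ∈ asSet (s k)
def EqE {T : NTy} (m n : UM U T) : Prop := EV fun k => m k = n k
def HoldsE {S : NTy} (p : Pd S) (c : UM U S) : Prop := EV fun k => Holds p (c k)
def Eqv {S : NTy} (c d : UM U S) : Prop := ∀ p : Pd S, HoldsE p c ↔ HoldsE p d

theorem Eqv.symm {S : NTy} {c d : UM U S} (h : Eqv c d) : Eqv d c := fun p => (h p).symm
theorem Eqv.ap {S T : NTy} {c d : UM U S} (h : Eqv c d) (f : Fn S T) : Eqv (ap f c) (ap f d) :=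
  fun p => h (p.comp f)

theorem Eqv.mem {S T : NTy} {c d : UM U S} (h : Eqv c d) (f : Fn S T) (g : Fn S (.set T)) :
    MemE (UM.ap f c) (UM.ap g c) ↔ MemE (UM.ap f d) (UM.ap g d) := by
  have := h (Pd.memP f g)
  simpa [HoldsE, MemE, UM.ap] using this

theorem Eqv.eqE {S T : NTy} {c d : UM U S} (h : Eqv c d) (f g : Fn S T) :
    EqE (UM.ap f c) (UM.ap g c) ↔ EqE (UM.ap f d) (UM.ap g d) := by
  have := h (Pd.eqP f g)
  simpa [HoldsE, EqE, UM.ap] using this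

instance {S : NTy} : Nonempty (Pd S) := ⟨Pd.tt⟩

theorem exists_conj {S : NTy} (e : ℕ → Pd S) (tr : ℕ → Prop) (n : ℕ) :
    ∃ χ : Pd S, ∀ (V : Type) (s : NObj V S), Holds χ s ↔ ∀ j ≤ n, (Holds (e j) s ↔ tr j) := by
  have lit : ∀ j, ∃ χ : Pd S, ∀ (V : Type) (s : NObj V S), Holds χ s ↔ (Holds (e j) s ↔ tr j) := by
    intro j
    by_cases h : tr j
    · exact ⟨e j, fun V s => by simp [h]⟩
    · exact ⟨Pd.not (e j), fun V s => by simp [h]⟩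
  induction n with
  | zero =>
    obtain ⟨χ, h⟩ := lit 0
    exact ⟨χ, fun V s => by simp [h]⟩
  | succ n ih =>
    obtain ⟨χ, h⟩ := lit (n+1)
    obtain ⟨χ', h'⟩ := ih
    refine ⟨Pd.and χ χ', fun V s => ?_⟩
    simp only [Pd.holds_and, h, h']
    constructor
    · rintro ⟨h1, h2⟩ j hj
      rcases Nat.lt_or_ge j (n+1) with h' | h'
      · exact h2 j (by omega)
      · obtain rfl : j = n+1 := by omega
        exact h1
    · intro h
      exact ⟨h _ le_rfl, fun j hj => h j (by omega)⟩

variable [hU : ∀ k, Nonempty (U k)]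

theorem back_forth {S T : NTy} {c d : UM U S} (h : Eqv c d) (g : Fn S (.set T)) (m : UM U T)
    (hm : MemE m (ap g c)) : ∃ m' : UM U T, MemE m' (ap g d) ∧ Eqv (mk m c) (mk m' d) := by
  obtain ⟨e, he⟩ := exists_surjective_nat (Pd (.prod T S))
  have : ∀ k, Nonempty (NObj (U k) T) := fun k => NObj.nonempty T
  obtain ⟨m', hm'⟩ := EV.saturation (Z := fun k => NObj (U k) T)
    (fun j k z => z ∈ asSet (g.eval (d k)) ∧
      (Holds (e j) (pr z (d k)) ↔ HoldsE (e j) (mk m c))) (by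
    intro n
    obtain ⟨χ, hχ⟩ := exists_conj e (fun j => HoldsE (e j) (mk m c)) n
    have h1 : EV fun k => Holds χ (pr (m k) (c k)) := by
      have := EV.all_le (Q := fun j k => Holds (e j) (mk m c k) ↔ HoldsE (e j) (mk m c)) n
        (fun j _ => EV.decide)
      exact this.mono fun k hk => (hχ _ _).2 hk
    have h2 : HoldsE (Pd.ex g χ) c := (h1.and hm).mono fun k hk => ⟨m k, hk.2, hk.1⟩
    have h3 := (h _).1 h2
    refine EV.mono h3 fun k hk => ?_
    obtain ⟨z, hz, hz'⟩ := hk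
    exact ⟨z, fun j hj => ⟨hz, (hχ _ _).1 hz' j hj⟩⟩)
  refine ⟨m', (hm' 0).mono fun k hk => hk.1, fun p => ?_⟩
  obtain ⟨j, rfl⟩ := he p
  have h1 := (hm' j).mono fun k hk => hk.2
  have := EV.congr h1
  have h2 : EV (fun _ => HoldsE (e j) (mk m c)) ↔ HoldsE (e j) (mk m c) :=
    ⟨fun h => (EV.exists_of h).choose_spec, fun h => EV.of_all fun _ => h⟩
  rw [h2] at this
  exact this.symm

theorem mismatch {S T : NTy} {c d : UM U S} (h : Eqv c d) (G : Fn S (.set T))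
    (x y : UM U (.set T)) (hx : EV fun k => asSet (x k) ⊆ asSet (G.eval (c k)))
    (hE : ∀ E : Fn S (.set (.set T)), ¬ MemE x (ap E c)) :
    ∃ z z' : UM U T, MemE z (ap G c) ∧ MemE z' (ap G d) ∧ Eqv (mk z c) (mk z' d) ∧
      ¬ (MemE z x ↔ MemE z' y) := by
  obtain ⟨e, he⟩ := exists_surjective_nat (Pd (.prod T S))
  have : ∀ k, Nonempty (NObj (U k) T) := fun k => NObj.nonempty T
  by_contra hcon
  have hn : ¬ ∀ n, EV fun k => ∃ z : NObj (U k) T × NObj (U k) T, ∀ j ≤ n,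
      z.1 ∈ asSet (G.eval (c k)) ∧ z.2 ∈ asSet (G.eval (d k)) ∧
      (Holds (e j) (pr z.1 (c k)) ↔ Holds (e j) (pr z.2 (d k))) ∧
      ¬ (z.1 ∈ asSet (x k) ↔ z.2 ∈ asSet (y k)) := by
    intro hall
    obtain ⟨w, hw⟩ := EV.saturation (Z := fun k => NObj (U k) T × NObj (U k) T) _ hall
    refine hcon ⟨fun k => (w k).1, fun k => (w k).2, (hw 0).mono fun k hk => hk.1,
      (hw 0).mono fun k hk => hk.2.1, fun p => ?_, fun hiff => ?_⟩
    · obtain ⟨j, rfl⟩ := he p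
      exact EV.congr ((hw j).mono fun k hk => hk.2.2.1)
    · have h1 := (hw 0).mono fun k hk => hk.2.2.2
      have h2 : EV fun k => (w k).1 ∈ asSet (x k) ↔ MemE (fun k => (w k).1) x := EV.decide
      have h3 : EV fun k => (w k).2 ∈ asSet (y k) ↔ MemE (fun k => (w k).2) y := EV.decide
      obtain ⟨k, hk⟩ := EV.exists_of (h1.and (h2.and h3))
      rw [hk.2.1, hk.2.2] at hk
      exact hk.1 hiff
  obtain ⟨n, hn⟩ := not_forall.1 hn
  rw [← EV.not_iff] at hn
  let L : List (Pd (.prod T S)) := (List.range (n+1)).map e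
  have hL : ∀ p : Pd (.prod T S), p ∈ L ↔ ∃ j ≤ n, e j = p := by
    intro p
    simp only [L, List.mem_map, List.mem_range, Nat.lt_succ_iff]
  -- agreement on L forces the same membership in x
  have hag : EV fun k => ∀ z1 z2 : NObj (U k) T, z1 ∈ asSet (G.eval (c k)) →
      z2 ∈ asSet (G.eval (c k)) →
      (∀ p ∈ L, Holds p (pr z1 (c k)) ↔ Holds p (pr z2 (c k))) →
      z1 ∈ asSet (x k) → z2 ∈ asSet (x k) := by
    by_contra hbad
    rw [← EV.not_iff] at hbad
    have hbad' : EV fun k => ∃ w : NObj (U k) T × NObj (U k) T, w.1 ∈ asSet (G.eval (c k)) ∧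
      w.2 ∈ asSet (G.eval (c k)) ∧
      (∀ p ∈ L, Holds p (pr w.1 (c k)) ↔ Holds p (pr w.2 (c k))) ∧
      w.1 ∈ asSet (x k) ∧ ¬ w.2 ∈ asSet (x k) := hbad.mono fun k hk => by
        push Not at hk
        obtain ⟨z1, z2, h⟩ := hk
        exact ⟨(z1, z2), h⟩
    obtain ⟨w, hw⟩ := EV.choice (Z := fun k => NObj (U k) T × NObj (U k) T) hbad'
    obtain ⟨z', hz', heq⟩ := back_forth h G (fun k => (w k).1) (hw.mono fun k hk => hk.1)
    have hLz : EV fun k => ∀ p ∈ L, Holds p (pr (w k).1 (c k)) ↔ Holds p (pr (z' k) (d k)) := by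
      apply EV.all_list
      intro p _
      have h1 : EV fun k => Holds p (mk (fun k => (w k).1) c k) ↔ HoldsE p (mk (fun k => (w k).1) c) :=
        EV.decide
      have h2 : EV fun k => Holds p (mk z' d k) ↔ HoldsE p (mk z' d) := EV.decide
      exact (h1.and h2).mono fun k hk => (hk.1.trans (heq p)).trans hk.2.symm
    obtain ⟨k, ⟨a1, a2, a3, a4, a5⟩, b, b', b''⟩ := EV.exists_of (hw.and (hLz.and (hz'.and hn)))
    have step : ∀ z ∈ asSet (G.eval (c k)), (∀ p ∈ L, Holds p (pr z (c k)) ↔ Holds p (pr (z' k) (d k)))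
        → (z ∈ asSet (x k) ↔ z' k ∈ asSet (y k)) := by
      intro z hz hag
      by_contra hne
      apply b''
      refine ⟨(z, z' k), fun j hj => ⟨hz, b', hag _ ((hL _).2 ⟨j, hj, rfl⟩), hne⟩⟩
    have s1 := step _ a1 b
    have s2 := step _ a2 fun p hp => (a3 p hp).symm.trans (b p hp)
    exact a5 (s2.2 (s1.1 a4))
  apply hE (unionL ((Pd.bc L).map fun φ => Fn.sing.comp (Pd.filt G φ)))
  refine (hag.and hx).mono fun k hk => ?_
  obtain ⟨φ, hφ, hs⟩ := Pd.bc_spec (fun _ : NObj (U k) T => U k) (fun z => pr z (c k)) L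
    (fun z => z ∈ asSet (G.eval (c k))) (fun z => z ∈ asSet (x k)) (fun z1 z2 => hk.1 z1 z2)
  unfold ap
  rw [mem_unionL]
  refine ⟨_, List.mem_map.2 ⟨φ, hφ, rfl⟩, ?_⟩
  rw [Fn.eval_comp, Fn.mem_sing]
  apply NObj.set_ext
  intro z
  rw [Pd.mem_filt]
  exact ⟨fun hz => ⟨hk.2 hz, (hs z (hk.2 hz)).2 hz⟩, fun hz => (hs z hz.1).1 hz.2⟩

end UM

/-! ### Countable closures -/

/-- A closure requirement with two inputs and one output. -/
structure Rq (M : NTy → Type) where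
  A : NTy
  B : NTy
  C : NTy
  R : M A → M B → M C → Prop

theorem exists_closure {M : NTy → Type} (Q : Set (Rq M)) (hQ : Q.Countable)
    (N0 : ∀ T, Set (M T)) (h0 : ∀ T, (N0 T).Countable) :
    ∃ N : ∀ T, Set (M T), (∀ T, N0 T ⊆ N T) ∧ (∀ T, (N T).Countable) ∧
      ∀ q ∈ Q, ∀ a ∈ N q.A, ∀ b ∈ N q.B, (∃ c, q.R a b c) → ∃ c ∈ N q.C, q.R a b c := by
  let step : (∀ T, Set (M T)) → ∀ T, Set (M T) := fun N T =>
    N T ∪ ⋃ q ∈ Q, ⋃ a ∈ N q.A, ⋃ b ∈ N q.B, ⋃ (h : q.C = T), ⋃ (hex : ∃ c, q.R a b c),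
      {h ▸ hex.choose}
  let Ns : ℕ → ∀ T, Set (M T) := fun n => Nat.rec N0 (fun _ N => step N) n
  have hs : ∀ n T, Ns n T ⊆ Ns (n+1) T := fun n T => Set.subset_union_left
  have hmono : ∀ T, Monotone fun n => Ns n T := fun T => monotone_nat_of_le_succ fun n => hs n T
  have hc : ∀ n T, (Ns n T).Countable := by
    intro n
    induction n with
    | zero => exact h0
    | succ n ih =>
      intro T
      refine (ih T).union ?_
      refine hQ.biUnion fun q _ => (ih _).biUnion fun a _ => (ih _).biUnion fun b _ => ?_
      exact Set.countable_iUnion fun _ => Set.countable_iUnion fun _ => Set.countable_singleton _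
  refine ⟨fun T => ⋃ n, Ns n T, fun T => Set.subset_iUnion (fun n => Ns n T) 0,
    fun T => Set.countable_iUnion fun n => hc n T, ?_⟩
  intro q hq a ha b hb hex
  obtain ⟨n, hn⟩ := Set.mem_iUnion.1 ha
  obtain ⟨n', hn'⟩ := Set.mem_iUnion.1 hb
  refine ⟨hex.choose, Set.mem_iUnion.2 ⟨max n n' + 1, ?_⟩, hex.choose_spec⟩
  refine Or.inr ?_
  simp only [Set.mem_iUnion]
  exact ⟨q, hq, a, hmono _ (le_max_left n n') hn, b, hmono _ (le_max_right n n') hn', rfl, hex,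
    rfl⟩

namespace UM
variable {U : ℕ → Type}

structure Good {X : NTy} (x : UM U (.set X)) (N : ∀ T, Set (UM U T)) : Prop where
  countable : ∀ T, (N T).Countable
  app : ∀ {S T} (f : Fn S T) (n : UM U S), n ∈ N S → ap f n ∈ N T
  pair : ∀ {S T} (m : UM U S) (n : UM U T), m ∈ N S → n ∈ N T → UM.mk m n ∈ N (.prod S T)
  wit : ∀ {T} (s : UM U (.set T)), s ∈ N (.set T) → EV (fun k => ∃ z, z ∈ asSet (s k)) →
    ∃ z ∈ N T, MemE z s
  bf : ∀ {S T} (c d : UM U S) (g : Fn S (.set T)) (m : UM U T), c ∈ N S → d ∈ N S → m ∈ N T →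
    Eqv c d → MemE m (ap g c) → ∃ m' ∈ N T, MemE m' (ap g d) ∧ Eqv (UM.mk m c) (UM.mk m' d)
  mm : ∀ {S} (c d : UM U S) (G : Fn S (.set X)) (y : UM U (.set X)), c ∈ N S → d ∈ N S →
    y ∈ N (.set X) → Eqv c d → (EV fun k => asSet (x k) ⊆ asSet (G.eval (c k))) →
    (∀ E : Fn S (.set (.set X)), ¬ MemE x (ap E c)) →
    ∃ z ∈ N X, ∃ z' ∈ N X, MemE z (ap G c) ∧ MemE z' (ap G d) ∧
      Eqv (UM.mk z c) (UM.mk z' d) ∧ ¬ (MemE z x ↔ MemE z' y)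

theorem exists_good [hU : ∀ k, Nonempty (U k)] {X : NTy} (x : UM U (.set X))
    (N0 : ∀ T, Set (UM U T)) (h0 : ∀ T, (N0 T).Countable) :
    ∃ N : ∀ T, Set (UM U T), (∀ T, N0 T ⊆ N T) ∧ Good x N := by
  let q1 : (Σ S T, Fn S T) → Rq (UM U) := fun i => ⟨i.1, i.1, i.2.1, fun a _ c => c = ap i.2.2 a⟩
  let q2 : NTy × NTy → Rq (UM U) := fun i =>
    ⟨i.1, i.2, .prod i.1 i.2, fun a b c => c = mk a b⟩
  let q3 : NTy → Rq (UM U) := fun T => ⟨.set T, .set T, T, fun a _ c => MemE c a⟩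
  let q4 : (Σ S T, Fn S (.set T)) → Rq (UM U) := fun i =>
    ⟨.prod i.1 i.1, i.2.1, i.2.1, fun a m m' => MemE m' (ap i.2.2 (ap .snd a)) ∧
      Eqv (mk m (ap .fst a)) (mk m' (ap .snd a))⟩
  let q5 : (Σ S, Fn S (.set X)) → Rq (UM U) := fun i =>
    ⟨.prod i.1 i.1, .set X, .prod X X, fun a y w =>
      MemE (ap .fst w) (ap i.2 (ap .fst a)) ∧ MemE (ap .snd w) (ap i.2 (ap .snd a)) ∧
      Eqv (mk (ap .fst w) (ap .fst a)) (mk (ap .snd w) (ap .snd a)) ∧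
      ¬ (MemE (ap .fst w) x ↔ MemE (ap .snd w) y)⟩
  obtain ⟨N, hN0, hNc, hN⟩ := exists_closure
    (Set.range q1 ∪ (Set.range q2 ∪ (Set.range q3 ∪ (Set.range q4 ∪ Set.range q5))))
    ((Set.countable_range _).union ((Set.countable_range _).union ((Set.countable_range _).union
      ((Set.countable_range _).union (Set.countable_range _))))) N0 h0
  have app : ∀ {S T} (f : Fn S T) (n : UM U S), n ∈ N S → ap f n ∈ N T := by
    intro S T f n hn
    obtain ⟨c, hc, rfl⟩ := hN (q1 ⟨S, T, f⟩) (Or.inl ⟨_, rfl⟩) n hn n hn ⟨_, rfl⟩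
    exact hc
  have hmk : ∀ {S T} (m : UM U S) (n : UM U T), m ∈ N S → n ∈ N T → mk m n ∈ N (.prod S T) := by
    intro S T m n hm hn
    obtain ⟨c, hc, rfl⟩ := hN (q2 ⟨S, T⟩) (Or.inr (Or.inl ⟨_, rfl⟩)) m hm n hn ⟨_, rfl⟩
    exact hc
  refine ⟨N, hN0, ⟨hNc, app, hmk, ?_, ?_, ?_⟩⟩
  · intro T s hs h
    have : ∀ k, Nonempty (NObj (U k) T) := fun k => NObj.nonempty T
    exact hN (q3 T) (Or.inr (Or.inr (Or.inl ⟨_, rfl⟩))) s hs s hs (EV.choice h)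
  · intro S T c d g m hc hd hm heq hmem
    exact hN (q4 ⟨S, T, g⟩) (Or.inr (Or.inr (Or.inr (Or.inl ⟨_, rfl⟩)))) (mk c d) (hmk c d hc hd)
      m hm (back_forth heq g m hmem)
  · intro S c d G y hc hd hy heq hx hE
    obtain ⟨z, z', h⟩ := mismatch heq G x y hx hE
    obtain ⟨w, hw, hfin⟩ := hN (q5 ⟨S, G⟩) (Or.inr (Or.inr (Or.inr (Or.inr ⟨_, rfl⟩)))) (mk c d)
      (hmk c d hc hd) y hy ⟨mk z z', h⟩
    exact ⟨ap .fst w, app _ _ hw, ap .snd w, app _ _ hw, hfin⟩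

/-! ### The generic partial isomorphism -/

structure Cond (N : ∀ T, Set (UM U T)) {S0 : NTy} (c0 d0 : UM U S0) where
  S : NTy
  c : UM U S
  d : UM U S
  hc : c ∈ N S
  hd : d ∈ N S
  eqv : Eqv c d
  hH : ∃ H : Fn S0 (.set S), MemE c (ap H c0)
  base : ∃ r : Fn S S0, ap r c = c0 ∧ ap r d = d0

instance (N : ∀ T, Set (UM U T)) {S0 : NTy} (c0 d0 : UM U S0) : Preorder (Cond N c0 d0) where
  le p q := ∃ r : Fn q.S p.S, ap r q.c = p.c ∧ ap r q.d = p.d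
  le_refl p := ⟨Fn.id _, rfl, rfl⟩
  le_trans p q r := by
    rintro ⟨f, h1, h2⟩ ⟨g, h3, h4⟩
    refine ⟨f.comp g, ?_, ?_⟩
    · rw [← h1, ← h3]; rfl
    · rw [← h2, ← h4]; rfl

theorem Cond.le_def {N : ∀ T, Set (UM U T)} {S0 : NTy} {c0 d0 : UM U S0} {p q : Cond N c0 d0} :
    p ≤ q ↔ ∃ r : Fn q.S p.S, ap r q.c = p.c ∧ ap r q.d = p.d := Iff.rfl

theorem ap_fst_mk {S T : NTy} (m : UM U S) (n : UM U T) : ap .fst (mk m n) = m := rfl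
theorem ap_snd_mk {S T : NTy} (m : UM U S) (n : UM U T) : ap .snd (mk m n) = n := rfl

theorem Cond.extend {X : NTy} {x : UM U (.set X)} {N : ∀ T, Set (UM U T)} (good : Good x N)
    {S0 : NTy} {c0 d0 : UM U S0} (p : Cond N c0 d0) {T : NTy} (g : Fn p.S (.set T))
    (m m' : UM U T) (hm : m ∈ N T) (hm' : m' ∈ N T) (hmem : MemE m (ap g p.c))
    (heq : Eqv (UM.mk m p.c) (UM.mk m' p.d)) :
    ∃ q : Cond N c0 d0, p ≤ q ∧ ∃ t : Fn q.S T, ap t q.c = m ∧ ap t q.d = m' := by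
  obtain ⟨H, hH⟩ := p.hH
  obtain ⟨r, hr, hr'⟩ := p.base
  refine ⟨⟨.prod T p.S, UM.mk m p.c, UM.mk m' p.d, good.pair _ _ hm p.hc, good.pair _ _ hm' p.hd, heq,
    ⟨Fn.bigU (Fn.bigU (Fn.sing.comp (Fn.pair Fn.fst (Fn.fst.comp Fn.snd))) (g.comp Fn.fst)) H, ?_⟩,
    ⟨r.comp Fn.snd, hr, hr'⟩⟩, ⟨Fn.snd, ?_, ?_⟩, Fn.fst, ?_, ?_⟩
  rotate_left
  · exact ap_snd_mk m p.c
  · exact ap_snd_mk m' p.d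
  · exact ap_fst_mk m p.c
  · exact ap_fst_mk m' p.d
  refine (EV.and hH hmem).mono fun k hk => ?_
  refine ⟨p.c k, hk.1, m k, hk.2, rfl⟩

structure IsIso {X : NTy} (x : UM U (.set X)) (N : ∀ T, Set (UM U T)) {S0 : NTy}
    (c0 d0 : UM U S0) (h : ∀ {T}, UM U T → UM U T → Prop) : Prop where
  base : h c0 d0
  mem : ∀ {T} {m m' : UM U T}, h m m' → m ∈ N T ∧ m' ∈ N T
  app : ∀ {S T} (f : Fn S T) {m m' : UM U S}, h m m' → h (ap f m) (ap f m')
  forth : ∀ {T} {n n' : UM U (.set T)} {m : UM U T}, h n n' → m ∈ N T → MemE m n →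
    ∃ m', h m m' ∧ MemE m' n'
  back : ∀ {T} {n n' : UM U (.set T)} {m' : UM U T}, h n n' → m' ∈ N T → MemE m' n' →
    ∃ m, h m m' ∧ MemE m n
  eqE : ∀ {T} {m m' n n' : UM U T}, h m m' → h n n' → (EqE m n ↔ EqE m' n')
  dfn : ∀ {T} {m m' : UM U T}, h m m' → ∃ E : Fn S0 (.set T), MemE m (ap E c0)
  mm : ∀ G0 : Fn S0 (.set X), (EV fun k => asSet (x k) ⊆ asSet (G0.eval (c0 k))) →
    (∀ E : Fn S0 (.set (.set X)), ¬ MemE x (ap E c0)) →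
    ∀ y ∈ N (.set X), ∃ z z', h z z' ∧ ¬ (MemE z x ↔ MemE z' y)

theorem exists_iso {X : NTy} {x : UM U (.set X)} {N : ∀ T, Set (UM U T)} (good : Good x N)
    {S0 : NTy} {c0 d0 : UM U S0} (hc0 : c0 ∈ N S0) (hd0 : d0 ∈ N S0) (heqv : Eqv c0 d0) :
    ∃ h : ∀ {T}, UM U T → UM U T → Prop, IsIso x N c0 d0 h := by
  let P := Cond N c0 d0
  let p0 : P := ⟨S0, c0, d0, hc0, hd0, heqv, ⟨Fn.sing, EV.of_all fun k => rfl⟩, ⟨Fn.id _, rfl, rfl⟩⟩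
  let ι := (Σ T, N T) ⊕ ((Σ T, N T) ⊕ N (.set X))
  have : ∀ T, Countable (N T) := fun T => (good.countable T).to_subtype
  have : Countable ι := inferInstance
  obtain ⟨henc⟩ := nonempty_encodable ι
  let HypX : Prop := ∃ G0 : Fn S0 (.set X), (EV fun k => asSet (x k) ⊆ asSet (G0.eval (c0 k))) ∧
    (∀ E : Fn S0 (.set (.set X)), ¬ MemE x (ap E c0))
  have dec : ∀ (B : P → Prop), IsCofinal {q : P | B q ∨ ∀ q' ≥ q, ¬ B q'} := by
    intro B q
    by_cases hq : ∃ q' ≥ q, B q'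
    · obtain ⟨q', h1, h2⟩ := hq
      exact ⟨q', Or.inl h2, h1⟩
    · push Not at hq
      exact ⟨q, Or.inr hq, le_rfl⟩
  let DB : ι → P → Prop := fun i => match i with
    | .inl a => fun q => ∃ t : Fn q.S a.1, ap t q.c = a.2.1
    | .inr (.inl a) => fun q => ∃ t : Fn q.S a.1, ap t q.d = a.2.1
    | .inr (.inr y) => fun q => ∃ t : Fn q.S X, ¬ (MemE (ap t q.c) x ↔ MemE (ap t q.d) y.1)
  let D : ι → Order.Cofinal P := fun i => ⟨_, dec (DB i)⟩
  let I := Order.idealOfCofinals p0 D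
  have hp0 : p0 ∈ I := Order.mem_idealOfCofinals p0 D
  have meets : ∀ i, ∃ q ∈ I, DB i q ∨ ∀ q' ≥ q, ¬ DB i q' := fun i => by
    obtain ⟨q, h1, h2⟩ := Order.cofinal_meets_idealOfCofinals p0 D i
    exact ⟨q, h2, h1⟩
  have dir : ∀ p ∈ I, ∀ q ∈ I, ∃ r ∈ I, p ≤ r ∧ q ≤ r := I.directed
  refine ⟨fun {T} m m' => ∃ p ∈ I, ∃ t : Fn p.S T, ap t p.c = m ∧ ap t p.d = m', ?_⟩
  have lift : ∀ {T} {p r : P} (t : Fn p.S T), p ≤ r → ∃ t' : Fn r.S T,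
      ap t' r.c = ap t p.c ∧ ap t' r.d = ap t p.d := by
    rintro T p r t ⟨f, h1, h2⟩
    exact ⟨t.comp f, by rw [← h1]; rfl, by rw [← h2]; rfl⟩
  constructor
  · exact ⟨p0, hp0, Fn.id _, rfl, rfl⟩
  · rintro T m m' ⟨p, -, t, rfl, rfl⟩
    exact ⟨good.app _ _ p.hc, good.app _ _ p.hd⟩
  · rintro S T f m m' ⟨p, hp, t, rfl, rfl⟩
    exact ⟨p, hp, f.comp t, rfl, rfl⟩
  · rintro T n n' m ⟨p, hp, g, rfl, rfl⟩ hm hmem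
    obtain ⟨q, hq, hq'⟩ := meets (.inl ⟨T, m, hm⟩)
    obtain ⟨r, hr, hpr, hqr⟩ := dir p hp q hq
    obtain ⟨g', hg1, hg2⟩ := lift g hpr
    rw [← hg1] at hmem
    rw [← hg2]
    rcases hq' with ⟨t, ht⟩ | hno
    · obtain ⟨t', ht1, ht2⟩ := lift t hqr
      change ap t q.c = m at ht
      refine ⟨ap t' r.d, ⟨r, hr, t', ht1.trans ht, rfl⟩, ?_⟩
      rw [← ht, ← ht1] at hmem
      exact (r.eqv.mem t' g').1 hmem
    · exfalso
      obtain ⟨m', hm', -, heq⟩ := good.bf r.c r.d g' m r.hc r.hd hm r.eqv hmem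
      obtain ⟨s, hrs, t, ht, -⟩ := Cond.extend good r g' m m' hm hm' hmem heq
      exact hno s (hqr.trans hrs) ⟨t, ht⟩
  · rintro T n n' m' ⟨p, hp, g, rfl, rfl⟩ hm' hmem'
    obtain ⟨q, hq, hq'⟩ := meets (.inr (.inl ⟨T, m', hm'⟩))
    obtain ⟨r, hr, hpr, hqr⟩ := dir p hp q hq
    obtain ⟨g', hg1, hg2⟩ := lift g hpr
    rw [← hg2] at hmem'
    rw [← hg1]
    rcases hq' with ⟨t, ht⟩ | hno
    · obtain ⟨t', ht1, ht2⟩ := lift t hqr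
      change ap t q.d = m' at ht
      refine ⟨ap t' r.c, ⟨r, hr, t', rfl, ht2.trans ht⟩, ?_⟩
      rw [← ht, ← ht2] at hmem'
      exact (r.eqv.mem t' g').2 hmem'
    · exfalso
      obtain ⟨m, hm, hmem, heq⟩ := good.bf r.d r.c g' m' r.hd r.hc hm' r.eqv.symm hmem'
      obtain ⟨s, hrs, t, -, ht⟩ := Cond.extend good r g' m m' hm hm' hmem heq.symm
      exact hno s (hqr.trans hrs) ⟨t, ht⟩
  · rintro T m m' n n' ⟨p, hp, g, rfl, rfl⟩ ⟨q, hq, t, rfl, rfl⟩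
    obtain ⟨r, hr, hpr, hqr⟩ := dir p hp q hq
    obtain ⟨g', hg1, hg2⟩ := lift g hpr
    obtain ⟨t', ht1, ht2⟩ := lift t hqr
    rw [← hg1, ← hg2, ← ht1, ← ht2]
    exact r.eqv.eqE g' t'
  · rintro T m m' ⟨p, hp, t, rfl, rfl⟩
    obtain ⟨H, hH⟩ := p.hH
    refine ⟨Fn.bigU (Fn.sing.comp (t.comp Fn.fst)) H, hH.mono fun k hk => ?_⟩
    exact ⟨p.c k, hk, rfl⟩
  · intro G0 hx hE y hy
    obtain ⟨q, hq, hq'⟩ := meets (.inr (.inr ⟨y, hy⟩))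
    rcases hq' with ⟨t, ht⟩ | hno
    · exact ⟨_, _, ⟨q, hq, t, rfl, rfl⟩, ht⟩
    · exfalso
      obtain ⟨r, hr1, hr2⟩ := q.base
      obtain ⟨H, hH⟩ := q.hH
      obtain ⟨z, hz, z', hz', h1, -, h3, h4⟩ := good.mm q.c q.d (G0.comp r) y q.hc q.hd hy q.eqv
        (by
          refine hx.mono fun k hk => ?_
          rw [Fn.eval_comp]
          have : r.eval (q.c k) = c0 k := congrFun hr1 k
          rwa [this])
        (by
          intro E hcon
          apply hE (Fn.bigU (E.comp Fn.fst) H)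
          exact (EV.and hH hcon).mono fun k hk => ⟨q.c k, hk.1, hk.2⟩)
      obtain ⟨s, hrs, t, ht, ht'⟩ := Cond.extend good q (G0.comp r) z z' hz hz' h1 h3
      refine hno s hrs ⟨t, ?_⟩
      rw [ht, ht']
      exact h4

/-! ### Gluing the atoms -/

theorem EqE.symm {T : NTy} {m n : UM U T} (h : EqE m n) : EqE n m := h.mono fun _ hk => hk.symm
theorem EqE.trans {T : NTy} {m n l : UM U T} (h : EqE m n) (h' : EqE n l) : EqE m l :=
  (EV.and h h').mono fun _ hk => hk.1.trans hk.2
theorem EqE.refl {T : NTy} (m : UM U T) : EqE m m := EV.of_all fun _ => rfl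

def std (U : ℕ → Type) : Setoid (UM U .ur) := ⟨EqE, ⟨EqE.refl, EqE.symm, EqE.trans⟩⟩

theorem exists_glue {X : NTy} {x : UM U (.set X)} {N : ∀ T, Set (UM U T)}
    {S0 : NTy} {c0 d0 : UM U S0} {h : ∀ {T}, UM U T → UM U T → Prop} (iso : IsIso x N c0 d0 h) :
    ∃ (W : Type) (e1 e2 : UM U .ur → W), (∀ m n, e1 m = e1 n ↔ EqE m n) ∧
      (∀ m n, e2 m = e2 n ↔ EqE m n) ∧ (∀ m m', h m m' → e1 m = e2 m') ∧
      (∀ m m', e1 m = e2 m' → ∃ n n', h n n' ∧ EqE m n) := by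
  let q : UM U .ur → Quotient (std U) := Quotient.mk (std U)
  have hq : ∀ m n, q m = q n ↔ EqE m n := fun m n => Quotient.eq (r := std U)
  let e1 : UM U .ur → Quotient (std U) ⊕ Quotient (std U) := fun m =>
    if hh : ∃ w : UM U .ur × UM U .ur, h w.1 w.2 ∧ EqE m w.1 then .inr (q hh.choose.2) else .inl (q m)
  have e1pos : ∀ m n n', h n n' → EqE m n → e1 m = .inr (q n') := by
    intro m n n' hn hmn
    have hh : ∃ w : UM U .ur × UM U .ur, h w.1 w.2 ∧ EqE m w.1 := ⟨(n, n'), hn, hmn⟩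
    have : e1 m = .inr (q hh.choose.2) := dif_pos hh
    rw [this]
    congr 1
    rw [hq]
    have hs := hh.choose_spec
    exact (iso.eqE hs.1 hn).1 (hs.2.symm.trans hmn)
  have e1neg : ∀ m, ¬ (∃ w : UM U .ur × UM U .ur, h w.1 w.2 ∧ EqE m w.1) → e1 m = .inl (q m) :=
    fun m hh => dif_neg hh
  refine ⟨_, e1, fun m => .inr (q m), ?_, ?_, ?_, ?_⟩
  · intro m n
    by_cases hm : ∃ w : UM U .ur × UM U .ur, h w.1 w.2 ∧ EqE m w.1
    · obtain ⟨⟨a, a'⟩, ha, hma⟩ := hm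
      by_cases hn : ∃ w : UM U .ur × UM U .ur, h w.1 w.2 ∧ EqE n w.1
      · obtain ⟨⟨b, b'⟩, hb, hnb⟩ := hn
        rw [e1pos _ _ _ ha hma, e1pos _ _ _ hb hnb, Sum.inr.injEq, hq, ← iso.eqE ha hb]
        exact ⟨fun h => (hma.trans h).trans hnb.symm, fun h => (hma.symm.trans h).trans hnb⟩
      · rw [e1pos _ _ _ ha hma, e1neg _ hn]
        refine ⟨fun h => by simp at h, fun h => absurd ⟨(a, a'), ha, h.symm.trans hma⟩ hn⟩
    · by_cases hn : ∃ w : UM U .ur × UM U .ur, h w.1 w.2 ∧ EqE n w.1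
      · obtain ⟨⟨b, b'⟩, hb, hnb⟩ := hn
        rw [e1pos _ _ _ hb hnb, e1neg _ hm]
        refine ⟨fun h => by simp at h, fun h => absurd ⟨(b, b'), hb, h.trans hnb⟩ hm⟩
      · rw [e1neg _ hm, e1neg _ hn, Sum.inl.injEq, hq]
  · intro m n
    rw [Sum.inr.injEq, hq]
  · intro m m' hm
    exact e1pos m m m' hm (EqE.refl m)
  · intro m m' he
    by_contra hcon
    rw [e1neg m (fun ⟨w, hw⟩ => hcon ⟨w.1, w.2, hw⟩)] at he
    simp at he

/-! ### Collapse -/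

def coll (N : ∀ T, Set (UM U T)) {W : Type} (e : UM U .ur → W) : ∀ {T : NTy}, UM U T → NObj W T
  | .ur, m => e m
  | .unit, _ => un
  | .prod _ _, m => pr (coll N e (ap .fst m)) (coll N e (ap .snd m))
  | .set _, s => mkS {y | ∃ z ∈ N _, MemE z s ∧ y = coll N e z}

section
variable {X : NTy} {x : UM U (.set X)} {N : ∀ T, Set (UM U T)}
  {W : Type} {e : UM U .ur → W}

theorem coll_mk {S T : NTy} (m : UM U S) (n : UM U T) :
    coll N e (mk m n) = pr (coll N e m) (coll N e n) := rfl

theorem mem_coll {T : NTy} (s : UM U (.set T)) (y : NObj W T) :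
    y ∈ asSet (coll N e s) ↔ ∃ z ∈ N T, MemE z s ∧ y = coll N e z := Iff.rfl

theorem MemE.congr {T : NTy} {m n : UM U T} {s : UM U (.set T)} (h : EqE m n) :
    MemE m s ↔ MemE n s := EV.congr (h.mono fun k hk => by rw [hk])

theorem coll_congr (he : ∀ m n, e m = e n ↔ EqE m n)
    {T : NTy} (m n : UM U T) (h : EqE m n) : coll N e m = coll N e n := by
  induction T with
  | ur => exact (he m n).2 h
  | unit => rfl
  | prod a b iha ihb =>
    have h1 := iha (ap .fst m) (ap .fst n) (h.mono fun k hk => by simp [ap, hk])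
    have h2 := ihb (ap .snd m) (ap .snd n) (h.mono fun k hk => by simp [ap, hk])
    change pr _ _ = pr _ _
    rw [h1, h2]
  | set a ih =>
    apply NObj.set_ext
    intro y
    rw [mem_coll, mem_coll]
    refine exists_congr fun z => and_congr_right fun _ => and_congr_left fun _ => ?_
    exact EV.congr (h.mono fun k hk => by rw [hk])

theorem coll_inj (good : Good x N) (he : ∀ m n, e m = e n ↔ EqE m n)
    {T : NTy} : ∀ (m n : UM U T), m ∈ N T → n ∈ N T → coll N e m = coll N e n →
    EqE m n := by
  induction T with
  | ur => intro m n _ _ h; exact (he m n).1 h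
  | unit => intro m n _ _ h; exact EV.of_all fun k => un_eq _ _
  | prod a b iha ihb =>
    intro m n hm hn h
    have h1 := iha _ _ (good.app .fst m hm) (good.app .fst n hn) (congrArg p1 h)
    have h2 := ihb _ _ (good.app .snd m hm) (good.app .snd n hn) (congrArg p2 h)
    refine (EV.and h1 h2).mono fun k hk => ?_
    rw [← pr_eta (m k), ← pr_eta (n k)]
    exact pr_inj.2 hk
  | set a ih =>
    have half : ∀ m n : UM U (.set a), m ∈ N _ → n ∈ N _ → coll N e m = coll N e n →
        EV fun k => ∀ z, z ∈ asSet (m k) → z ∈ asSet (n k) := by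
      intro m n hm hn h
      by_contra hcon
      rw [← EV.not_iff] at hcon
      have hd : ap (Fn.diff .fst .snd) (mk m n) ∈ N (.set a) := good.app _ _ (good.pair _ _ hm hn)
      obtain ⟨z, hz, hzm⟩ := good.wit _ hd (hcon.mono fun k hk => by
        push Not at hk
        obtain ⟨z, h1, h2⟩ := hk
        exact ⟨z, h1, h2⟩)
      have hz1 : MemE z m := hzm.mono fun k hk => hk.1
      have hz2 : EV fun k => ¬ z k ∈ asSet (n k) := hzm.mono fun k hk => hk.2
      rw [EV.not_iff] at hz2
      have : coll N e z ∈ asSet (coll N e n) := by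
        rw [← h]; exact ⟨z, hz, hz1, rfl⟩
      obtain ⟨w, hw, hwn, hzw⟩ := this
      exact hz2 ((MemE.congr (ih z w hz hw hzw)).2 hwn)
    intro m n hm hn h
    refine (EV.and (half m n hm hn h) (half n m hn hm h.symm)).mono fun k hk => ?_
    exact NObj.set_ext fun z => ⟨hk.1 z, hk.2 z⟩

theorem mem_coll_iff (good : Good x N) (he : ∀ m n, e m = e n ↔ EqE m n)
    {T : NTy} (z : UM U T) (s : UM U (.set T)) (hz : z ∈ N T) :
    coll N e z ∈ asSet (coll N e s) ↔ MemE z s := by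
  constructor
  · rintro ⟨w, hw, hws, h⟩
    exact (MemE.congr (coll_inj good he z w hz hw h)).2 hws
  · intro h
    exact ⟨z, hz, h, rfl⟩

theorem coll_ap (good : Good x N) (he : ∀ m n, e m = e n ↔ EqE m n)
    {S T : NTy} (f : Fn S T) : ∀ n : UM U S, n ∈ N S →
    coll N e (ap f n) = f.eval (coll N e n) := by
  induction f with
  | id => intro n _; rfl
  | comp f g ihf ihg =>
    intro n hn
    rw [Fn.eval_comp, ← ihg n hn, ← ihf _ (good.app _ _ hn)]
    rfl
  | unit => intro n _; rfl
  | pair f g ihf ihg =>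
    intro n hn
    rw [Fn.eval_pair, ← ihg n hn, ← ihf n hn]
    rfl
  | fst => intro n _; rfl
  | snd => intro n _; rfl
  | sing =>
    intro n hn
    apply NObj.set_ext
    intro y
    rw [mem_coll, Fn.mem_sing]
    constructor
    · rintro ⟨z, hz, hzn, rfl⟩
      exact coll_congr he z n hzn
    · rintro rfl
      exact ⟨n, hn, EV.of_all fun k => rfl, rfl⟩
  | empty =>
    intro n hn
    apply NObj.set_ext
    intro y
    rw [mem_coll, Fn.mem_empty]
    constructor
    · rintro ⟨z, hz, hzn, rfl⟩
      obtain ⟨k, hk⟩ := EV.exists_of hzn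
      exact hk
    · exact False.elim
  | union f g ihf ihg =>
    intro n hn
    apply NObj.set_ext
    intro y
    rw [mem_coll, Fn.mem_union, ← ihf n hn, ← ihg n hn, mem_coll, mem_coll]
    constructor
    · rintro ⟨z, hz, hzn, rfl⟩
      rcases EV.or_iff.1 hzn with h | h
      · exact Or.inl ⟨z, hz, h, rfl⟩
      · exact Or.inr ⟨z, hz, h, rfl⟩
    · rintro (⟨z, hz, hzn, rfl⟩ | ⟨z, hz, hzn, rfl⟩)
      · exact ⟨z, hz, hzn.mono fun k hk => Or.inl hk, rfl⟩
      · exact ⟨z, hz, hzn.mono fun k hk => Or.inr hk, rfl⟩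
  | diff f g ihf ihg =>
    intro n hn
    apply NObj.set_ext
    intro y
    rw [mem_coll, Fn.mem_diff, ← ihf n hn, ← ihg n hn]
    constructor
    · rintro ⟨z, hz, hzn, rfl⟩
      rw [mem_coll_iff good he _ _ hz, mem_coll_iff good he _ _ hz]
      obtain ⟨h1, h2⟩ := EV.and_iff.1 hzn
      exact ⟨h1, EV.not_iff.1 h2⟩
    · rintro ⟨⟨z, hz, hzn, rfl⟩, h⟩
      rw [mem_coll_iff good he _ _ hz] at h
      exact ⟨z, hz, EV.and_iff.2 ⟨hzn, EV.not_iff.2 h⟩, rfl⟩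
  | @bigU S A T f g ihf ihg =>
    intro n hn
    apply NObj.set_ext
    intro y
    rw [mem_coll, Fn.mem_bigU, ← ihg n hn]
    constructor
    · rintro ⟨z, hz, hzn, rfl⟩
      let F : Fn (.prod T S) (.set A) := Pd.filt (g.comp .snd)
        (Pd.memP (Fn.fst.comp .snd) (f.comp (Fn.pair .fst (Fn.snd.comp .snd))))
      obtain ⟨w, hw, hwm⟩ := good.wit (ap F (mk z n)) (good.app _ _ (good.pair _ _ hz hn)) (by
        refine EV.mono hzn fun k hk => ?_
        obtain ⟨w, h1, h2⟩ := hk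
        exact ⟨w, by simpa [ap, F, mk] using ⟨h1, h2⟩⟩)
      have hwm' : EV fun k => w k ∈ asSet (g.eval (n k)) ∧
          z k ∈ asSet (f.eval (pr (w k) (n k))) := by
        refine EV.mono hwm fun k hk => ?_
        simpa [ap, F, mk] using hk
      obtain ⟨h1, h2⟩ := EV.and_iff.1 hwm'
      refine ⟨coll N e w, ⟨w, hw, h1, rfl⟩, ?_⟩
      rw [← coll_mk, ← ihf _ (good.pair _ _ hw hn)]
      exact ⟨z, hz, h2, rfl⟩
    · rintro ⟨_, ⟨w, hw, hwn, rfl⟩, h⟩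
      rw [← coll_mk, ← ihf _ (good.pair _ _ hw hn)] at h
      obtain ⟨z, hz, hzm, rfl⟩ := h
      exact ⟨z, hz, (EV.and hwn hzm).mono fun k hk => ⟨w k, hk.1, hk.2⟩, rfl⟩

theorem coll_holds (good : Good x N) (he : ∀ m n, e m = e n ↔ EqE m n)
    {S : NTy} (p : Pd S) (n : UM U S) (hn : n ∈ N S) :
    Holds p (coll N e n) ↔ HoldsE p n := by
  unfold Holds
  rw [← coll_ap good he p n hn]
  constructor
  · rintro ⟨z, hz, hzm, -⟩
    exact hzm
  · intro h
    exact ⟨fun k => un, good.app .unit n hn, h, rfl⟩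

end

theorem coll_iso {X : NTy} {x : UM U (.set X)} {N : ∀ T, Set (UM U T)}
    {S0 : NTy} {c0 d0 : UM U S0} {h : ∀ {T}, UM U T → UM U T → Prop} (iso : IsIso x N c0 d0 h)
    {W : Type} {e1 e2 : UM U .ur → W} (he : ∀ m m', h m m' → e1 m = e2 m') {T : NTy} :
    ∀ {m m' : UM U T}, h m m' → coll N e1 m = coll N e2 m' := by
  induction T with
  | ur => intro m m' hm; exact he m m' hm
  | unit => intro m m' _; rfl
  | prod a b iha ihb =>
    intro m m' hm
    have h1 := iha (iso.app .fst hm)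
    have h2 := ihb (iso.app .snd hm)
    change pr _ _ = pr _ _
    rw [h1, h2]
  | set a ih =>
    intro m m' hm
    apply NObj.set_ext
    intro y
    rw [mem_coll, mem_coll]
    constructor
    · rintro ⟨z, hz, hzm, rfl⟩
      obtain ⟨z', hzz, hz'⟩ := iso.forth hm hz hzm
      exact ⟨z', (iso.mem hzz).2, hz', ih hzz⟩
    · rintro ⟨z', hz', hzm', rfl⟩
      obtain ⟨z, hzz, hz⟩ := iso.back hm hz' hzm'
      exact ⟨z, (iso.mem hzz).1, hz, (ih hzz).symm⟩

end UM

/-! ### Collection and interpolation -/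

namespace UM

theorem setup {U : ℕ → Type} [∀ k, Nonempty (U k)] {X : NTy} (x : UM U (.set X)) {B : NTy}
    (b : UM U B) {S0 : NTy} (c0 d0 : UM U S0) (fc fd : Fn B S0) (hc : ap fc b = c0)
    (hd : ap fd b = d0) (heqv : Eqv c0 d0) :
    ∃ N : ∀ T, Set (UM U T), b ∈ N B ∧ Good x N ∧
      ∃ h : ∀ {T}, UM U T → UM U T → Prop, IsIso x N c0 d0 h ∧
      ∃ (W : Type) (e1 e2 : UM U .ur → W), (∀ m n, e1 m = e1 n ↔ EqE m n) ∧
      (∀ m n, e2 m = e2 n ↔ EqE m n) ∧ (∀ m m', h m m' → e1 m = e2 m') ∧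
      (∀ m m', e1 m = e2 m' → ∃ n n', h n n' ∧ EqE m n) := by
  obtain ⟨N, hN, good⟩ := exists_good x (fun T => {m | ∃ h : B = T, m = h ▸ b}) (by
    intro T
    by_cases h : B = T
    · subst h
      refine (Set.countable_singleton b).mono ?_
      rintro m ⟨_, rfl⟩
      rfl
    · refine Set.countable_empty.mono ?_
      rintro m ⟨h', _⟩
      exact h h')
  have hb : b ∈ N B := hN B ⟨rfl, rfl⟩
  obtain ⟨h, iso⟩ := exists_iso good (c0 := c0) (d0 := d0) (hc ▸ good.app fc b hb)
    (hd ▸ good.app fd b hb) heqv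
  exact ⟨N, hb, good, h, iso, exists_glue iso⟩

end UM

open UM

theorem exists_seq {I O A T : NTy} (P : Pd (.prod I (.prod O A))) (p : Fn O (.set T))
    (hcon : ¬ ∃ E : Fn I (.set T), ∀ (U : Type) [Nonempty U] (i : NObj U I) (o : NObj U O)
      (a : NObj U A) (x : NObj U T), Holds P (pr i (pr o a)) → x ∈ asSet (p.eval o) →
      x ∈ asSet (E.eval i)) :
    ∃ (U : ℕ → Type) (_ : ∀ k, Nonempty (U k)) (i : UM U I) (o : UM U O) (a : UM U A) (x : UM U T),
      (∀ k, Holds P (pr (i k) (pr (o k) (a k)))) ∧ (∀ k, x k ∈ asSet (p.eval (o k))) ∧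
      ∀ E : Fn I (.set T), ¬ MemE x (ap E i) := by
  have : Nonempty (Fn I (.set T)) := ⟨.empty⟩
  obtain ⟨e, he⟩ := exists_surjective_nat (Fn I (.set T))
  push Not at hcon
  choose U hU i o a x h1 h2 h3 using fun k : ℕ => hcon (unionL ((List.range (k+1)).map e))
  refine ⟨U, hU, i, o, a, x, h1, h2, ?_⟩
  intro E hE
  obtain ⟨n, rfl⟩ := he E
  obtain ⟨k, hk, hn⟩ := (EV.and hE (EV.ge n)).exists_of
  apply h3 k
  rw [mem_unionL]
  exact ⟨e n, List.mem_map.2 ⟨n, List.mem_range.2 (by omega), rfl⟩, hk⟩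

theorem collection {I O A : NTy} (P : Pd (.prod I (.prod O A)))
    (himp : ∀ (U : Type) (i : NObj U I) (o : NObj U O) (a : NObj U A) (o' : NObj U O)
      (a' : NObj U A), Holds P (pr i (pr o a)) → Holds P (pr i (pr o' a')) → o = o') (T : NTy) :
    ∀ p : Fn O (.set T), ∃ E : Fn I (.set T), ∀ (U : Type) [Nonempty U] (i : NObj U I)
      (o : NObj U O) (a : NObj U A) (x : NObj U T), Holds P (pr i (pr o a)) →
      x ∈ asSet (p.eval o) → x ∈ asSet (E.eval i) := by
  induction T with
  | unit =>
    intro p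
    exact ⟨Fn.sing.comp .unit, fun U _ i o a x _ _ => un_eq _ _⟩
  | prod S T ihS ihT =>
    intro p
    obtain ⟨E1, h1⟩ := ihS (Fn.bigU (Fn.sing.comp (Fn.fst.comp .fst)) p)
    obtain ⟨E2, h2⟩ := ihT (Fn.bigU (Fn.sing.comp (Fn.snd.comp .fst)) p)
    refine ⟨Fn.bigU (Fn.bigU (Fn.sing.comp (Fn.pair (Fn.fst.comp .snd) .fst)) (E2.comp .snd)) E1,
      ?_⟩
    intro U _ i o a x hP hx
    refine ⟨p1 x, h1 U i o a _ hP ⟨x, hx, rfl⟩, p2 x, h2 U i o a _ hP ⟨x, hx, rfl⟩, rfl⟩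
  | ur =>
    intro p
    by_contra hcon
    obtain ⟨U, hU, i, o, a, x, hP, hx, hE⟩ := exists_seq P p hcon
    obtain ⟨N, hb, good, h, iso, W, e1, e2, he1, he2, he, heq⟩ :=
      setup (X := .ur) (fun k => mkS ∅) (mk (mk i (mk o a)) x) i i (Fn.fst.comp .fst)
        (Fn.fst.comp .fst) rfl rfl (fun _ => Iff.rfl)
    have hPN : mk i (mk o a) ∈ N _ := good.app .fst _ hb
    have hoN : o ∈ N _ := good.app (Fn.fst.comp .snd) _ hPN
    have hxN : x ∈ N _ := good.app .snd _ hb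
    have hH : HoldsE P (mk i (mk o a)) := EV.of_all hP
    have c1 := (coll_holds good he1 P _ hPN).2 hH
    have c2 := (coll_holds good he2 P _ hPN).2 hH
    rw [coll_mk, coll_mk] at c1 c2
    rw [coll_iso iso he iso.base] at c1
    have ho := himp W _ _ _ _ _ c1 c2
    have hmem := (mem_coll_iff good he1 x (ap p o) hxN).2 (EV.of_all hx)
    rw [coll_ap good he1 p o hoN, ho, ← coll_ap good he2 p o hoN] at hmem
    obtain ⟨y, hy, -, hxy⟩ := hmem
    obtain ⟨n, n', hn, hxn⟩ := heq x y hxy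
    obtain ⟨E, hEn⟩ := iso.dfn hn
    exact hE E ((MemE.congr hxn).2 hEn)
  | set T ih =>
    intro p
    by_contra hcon
    obtain ⟨G, hG⟩ := ih (Fn.bigU .fst p)
    obtain ⟨U, hU, i, o, a, x, hP, hx, hE⟩ := exists_seq P p hcon
    obtain ⟨N, hb, good, h, iso, W, e1, e2, he1, he2, he, heq⟩ :=
      setup (X := T) x (mk (mk i (mk o a)) x) i i (Fn.fst.comp .fst)
        (Fn.fst.comp .fst) rfl rfl (fun _ => Iff.rfl)
    have hPN : mk i (mk o a) ∈ N _ := good.app .fst _ hb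
    have hoN : o ∈ N _ := good.app (Fn.fst.comp .snd) _ hPN
    have hxN : x ∈ N _ := good.app .snd _ hb
    have hH : HoldsE P (mk i (mk o a)) := EV.of_all hP
    have c1 := (coll_holds good he1 P _ hPN).2 hH
    have c2 := (coll_holds good he2 P _ hPN).2 hH
    rw [coll_mk, coll_mk] at c1 c2
    rw [coll_iso iso he iso.base] at c1
    have ho := himp W _ _ _ _ _ c1 c2
    have hmem := (mem_coll_iff good he1 x (ap p o) hxN).2 (EV.of_all hx)
    rw [coll_ap good he1 p o hoN, ho, ← coll_ap good he2 p o hoN] at hmem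
    obtain ⟨y, hy, -, hxy⟩ := hmem
    obtain ⟨z, z', hz, hne⟩ := iso.mm G (EV.of_all fun k w hw =>
      hG (U k) (i k) (o k) (a k) w (hP k) ⟨x k, hx k, hw⟩) hE y hy
    apply hne
    rw [← mem_coll_iff good he1 z x (iso.mem hz).1, ← mem_coll_iff good he2 z' y (iso.mem hz).2,
      hxy, coll_iso iso he hz]

structure Pt {I O A : NTy} (P : Pd (.prod I (.prod O A))) (E : Fn I (.set O)) where
  U : Type
  ne : Nonempty U
  i : NObj U I
  o : NObj U O
  a : NObj U A
  x : NObj U O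
  hP : Holds P (pr i (pr o a))
  hx : x ∈ asSet (E.eval i)

theorem interpolation {I O A : NTy} (P : Pd (.prod I (.prod O A)))
    (himp : ∀ (U : Type) (i : NObj U I) (o : NObj U O) (a : NObj U A) (o' : NObj U O)
      (a' : NObj U A), Holds P (pr i (pr o a)) → Holds P (pr i (pr o' a')) → o = o')
    (E : Fn I (.set O)) :
    ∃ φ : Pd (.prod O I), ∀ q : Pt P E, Holds φ (pr q.x q.i) ↔ q.x = q.o := by
  by_contra hcon
  push Not at hcon
  obtain ⟨e, he⟩ := exists_surjective_nat (Pd (.prod O I))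
  have hk : ∀ k : ℕ, ∃ q r : Pt P E, (∀ n ≤ k, Holds (e n) (pr q.x q.i) ↔ Holds (e n) (pr r.x r.i)) ∧
      q.x = q.o ∧ r.x ≠ r.o := by
    intro k
    by_contra hno
    push Not at hno
    obtain ⟨φ, -, hφ⟩ := Pd.bc_spec (fun q : Pt P E => q.U) (fun q => pr q.x q.i)
      ((List.range (k+1)).map e) (fun _ => True) (fun q => q.x = q.o) (by
        intro q r _ _ h hq
        refine hno q r (fun n hn => h _ ?_) hq
        exact List.mem_map.2 ⟨n, List.mem_range.2 (by omega), rfl⟩)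
    obtain ⟨q, hq⟩ := hcon φ
    have := hφ q trivial
    tauto
  choose q r hqr hq hr using hk
  let U : ℕ → Type := fun k => (q k).U ⊕ (r k).U
  have hU : ∀ k, Nonempty (U k) := fun k => (q k).ne.map Sum.inl
  let l : ∀ k {T}, NObj (q k).U T → NObj (U k) T := fun k _ => NObj.map Sum.inl
  let l' : ∀ k {T}, NObj (r k).U T → NObj (U k) T := fun k _ => NObj.map Sum.inr
  let i : UM U I := fun k => l k (q k).i
  let o : UM U O := fun k => l k (q k).o
  let a : UM U A := fun k => l k (q k).a
  let i' : UM U I := fun k => l' k (r k).i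
  let o' : UM U O := fun k => l' k (r k).o
  let a' : UM U A := fun k => l' k (r k).a
  let x' : UM U O := fun k => l' k (r k).x
  have hP : HoldsE P (mk i (mk o a)) := EV.of_all fun k =>
    (holds_map Sum.inl Sum.inl_injective P (pr (q k).i (pr (q k).o (q k).a))).2 (q k).hP
  have hP' : HoldsE P (mk i' (mk o' a')) := EV.of_all fun k =>
    (holds_map Sum.inr Sum.inr_injective P (pr (r k).i (pr (r k).o (r k).a))).2 (r k).hP
  have hne : ¬ EqE x' o' := by
    intro h
    obtain ⟨k, hk⟩ := h.exists_of
    exact hr k (map_inj Sum.inr Sum.inr_injective _ _ hk)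
  have heqv : Eqv (mk o i) (mk x' i') := by
    intro φ
    obtain ⟨n, rfl⟩ := he φ
    refine EV.congr ((EV.ge n).mono fun k hk => ?_)
    have h1 := holds_map Sum.inl Sum.inl_injective (V := U k) (e n) (pr (q k).o (q k).i)
    have h2 := holds_map Sum.inr Sum.inr_injective (V := U k) (e n) (pr (r k).x (r k).i)
    have h3 := hqr k n hk
    rw [hq k] at h3
    exact h1.trans (h3.trans h2.symm)
  obtain ⟨N, hb, good, h, iso, W, e1, e2, he1, he2, hee, -⟩ :=
    setup (X := .ur) (fun k => mkS ∅) (mk (mk i (mk o a)) (mk x' (mk i' (mk o' a'))))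
      (mk o i) (mk x' i')
      (Fn.pair (Fn.fst.comp (Fn.snd.comp .fst)) (Fn.fst.comp .fst))
      (Fn.pair (Fn.fst.comp .snd) (Fn.fst.comp (Fn.snd.comp .snd))) rfl rfl heqv
  have hPN : mk i (mk o a) ∈ N _ := good.app .fst _ hb
  have hPN' : mk i' (mk o' a') ∈ N _ := good.app (Fn.snd.comp .snd) _ hb
  have hxN : x' ∈ N _ := good.app (Fn.fst.comp .snd) _ hb
  have hoN : o' ∈ N _ := good.app (Fn.fst.comp .snd) _ hPN'
  have c1 := (coll_holds good he1 P _ hPN).2 hP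
  have c2 := (coll_holds good he2 P _ hPN').2 hP'
  have hb1 := coll_iso iso hee iso.base
  rw [coll_mk, coll_mk] at c1 c2 hb1
  obtain ⟨ho, hi⟩ := pr_inj.1 hb1
  rw [hi] at c1
  have hoo := himp W _ _ _ _ _ c1 c2
  exact hne (coll_inj good he2 x' o' hxN hoN (ho.symm.trans hoo))

theorem core {I O A : NTy} (P : Pd (.prod I (.prod O A)))
    (himp : ∀ (U : Type) (i : NObj U I) (o : NObj U O) (a : NObj U A) (o' : NObj U O)
      (a' : NObj U A), Holds P (pr i (pr o a)) → Holds P (pr i (pr o' a')) → o = o') :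
    ∃ F : Fn I (.set O), ∀ (U : Type) [Nonempty U] (i : NObj U I) (o : NObj U O) (a : NObj U A),
      Holds P (pr i (pr o a)) → F.eval i = mkS {o} := by
  obtain ⟨E, hE⟩ := collection P himp O .sing
  obtain ⟨φ, hφ⟩ := interpolation P himp E
  refine ⟨Pd.filt E φ, fun U hU i o a hP => NObj.set_ext fun z => ?_⟩
  rw [Pd.mem_filt]
  constructor
  · rintro ⟨h1, h2⟩
    exact (hφ ⟨U, hU, i, o, a, z, hP, h1⟩).1 h2
  · intro h
    have hz : z = o := h
    subst hz
    have h1 := hE U i z a z hP rfl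
    exact ⟨h1, (hφ ⟨U, hU, i, z, a, z, hP, h1⟩).2 rfl⟩

/-- **Implicit-to-explicit for nested relations** (Theorem 3.2): if a Δ₀ formula
`Σ(o_in, o_out, a)` implicitly defines `o_out` as a function of `o_in` — over all, possibly
infinite, nested relational instances — then there is an `NRC` expression `E` in the single
variable `o_in` such that whenever `Σ(o_in, o_out, a)` holds, `E(o_in) = o_out`. -/
theorem implicit_to_explicit_nrc {Tin Tout Ta : NTy} (Sg : D0 [Tin, Tout, Ta])
    (himp : ∀ (U : Type) (i : NObj U Tin) (o : NObj U Tout) (a : NObj U Ta)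
      (o' : NObj U Tout) (a' : NObj U Ta),
      Sg.Sat (mk3 i o a) → Sg.Sat (mk3 i o' a') → o = o') :
    ∃ E : NRC [Tin] Tout,
      ∀ (U : Type) [Inhabited U] (i : NObj U Tin) (o : NObj U Tout) (a : NObj U Ta),
        Sg.Sat (mk3 i o a) → E.eval (mk1 i) = o := by
  obtain ⟨P, hP⟩ := D0.tr Sg
  have key : ∀ (U : Type) (i : NObj U Tin) (o : NObj U Tout) (a : NObj U (.prod Ta .unit)),
      Holds (S := .prod Tin (.prod Tout (.prod Ta .unit))) P (pr i (pr o a)) →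
      Sg.Sat (mk3 i o (p1 a)) := fun U i o a h => (hP U (mk3 i o (p1 a))).1 h
  obtain ⟨F, hF⟩ := core (I := Tin) (O := Tout) (A := .prod Ta .unit) P
    (fun U i o a o' a' h h' => himp U i o (p1 a) o' (p1 a') (key U i o a h) (key U i o' a' h'))
  obtain ⟨e, he⟩ := F.toNRC (NRC.var (Γ := [Tin]) ⟨0, Nat.succ_pos _⟩)
  refine ⟨NRC.get e, fun U hU i o a h => ?_⟩
  have h1 : e.eval (mk1 i) = ({o} : Set (NObj U Tout)) :=
    (he U (mk1 i)).trans (hF U i o (pr a un) ((hP U (mk3 i o a)).2 h))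
  have hex : ∃ x, e.eval (mk1 i) = ({x} : Set (NObj U Tout)) := ⟨o, h1⟩
  have h2 : (NRC.get e).eval (mk1 i) = hex.choose := by
    rw [NRC.eval]
    exact dif_pos hex
  rw [h2]
  have h3 : ({hex.choose} : Set (NObj U Tout)) = {o} := hex.choose_spec.symm.trans h1
  exact Set.singleton_injective h3
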